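/- arXiv:1704.01738 — 2 statements merged into one kernel-verified Lean document; each statement's English description precedes it below -/
import Mathlib

section
/- Let f ∈ ℤ[X] be a nonconstant polynomial, let K be the splitting field of f over ℚ, let G = Gal(K/ℚ), let R be the set of roots of f in K, and set δ_f = #{σ ∈ G : σ(α) = α for some α ∈ R} / #G. Let 𝒫_f be the set of primes p dividing f(n) for some positive integer n. Then there exists a constant C > 0 (depending only on f) such that for all integers N ≥ 2, | ∑_{p ∈ 𝒫_f, p ≤ N} (log p)/(p − 1) − δ_f log N | ≤ C. -/
open Polynomial
open scoped BigOperators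

/-- If the partial sums of `a` are at most `c * N`, then weighting by an antitone sequence `w`
costs at most a factor `c`. -/
theorem sum_mul_le_of_sum_le_of_antitone {a w : ℕ → ℝ} {c : ℝ} (hw : Antitone w)
    (hw0 : ∀ n, 0 ≤ w n) (ha : ∀ N : ℕ, ∑ n ∈ Finset.range N, a n ≤ c * N) (N : ℕ) :
    ∑ n ∈ Finset.range N, a n * w n ≤ c * ∑ n ∈ Finset.range N, w n := by
  have key : ∀ N : ℕ, ∑ n ∈ Finset.range (N + 1), a n * w n ≤
      c * ∑ n ∈ Finset.range (N + 1), w n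
        - (c * (N + 1 : ℕ) - ∑ n ∈ Finset.range (N + 1), a n) * w N := by
    intro N
    induction N with
    | zero => simp; linarith
    | succ N ih =>
      rw [Finset.sum_range_succ, Finset.sum_range_succ w, Finset.sum_range_succ a]
      have h1 : 0 ≤ c * (N + 1 : ℕ) - ∑ n ∈ Finset.range (N + 1), a n := by
        linarith [ha (N + 1)]
      have h2 := mul_le_mul_of_nonneg_left (hw (Nat.le_succ N)) h1
      push_cast at *
      linarith
  rcases N with _ | N
  · simp
  · have h1 : 0 ≤ c * (N + 1 : ℕ) - ∑ n ∈ Finset.range (N + 1), a n := by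
      linarith [ha (N + 1)]
    linarith [key N, mul_nonneg h1 (hw0 N)]

theorem sum_rpow_sub_one_le {e : ℝ} (he0 : 0 < e) (he1 : e ≤ 1) (N : ℕ) :
    ∑ n ∈ Finset.range N, ((n : ℝ) + 1) ^ (e - 1) ≤ e⁻¹ * (N : ℝ) ^ e := by
  induction N with
  | zero => simp [Real.zero_rpow he0.ne']
  | succ N ih =>
    rw [Finset.sum_range_succ]
    have hN : (0 : ℝ) < N + 1 := by positivity
    have h1 : (1 + -(1 / ((N : ℝ) + 1))) ^ e ≤ 1 + e * (-(1 / ((N : ℝ) + 1))) := by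
      apply rpow_one_add_le_one_add_mul_self _ he0.le he1
      rw [neg_le_neg_iff, div_le_one hN]
      linarith [(Nat.cast_nonneg N : (0 : ℝ) ≤ N)]
    have h2 : (1 + -(1 / ((N : ℝ) + 1))) = N / (N + 1) := by field_simp; ring
    rw [h2, Real.div_rpow (by positivity) hN.le, div_le_iff₀ (by positivity)] at h1
    have h3 : ((N : ℝ) + 1) ^ (e - 1) = ((N : ℝ) + 1) ^ e / (N + 1) := by
      rw [Real.rpow_sub hN, Real.rpow_one]
    have h4 : ((N : ℝ) + 1) ^ (e - 1) ≤ e⁻¹ * (((N : ℝ) + 1) ^ e - (N : ℝ) ^ e) := by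
      rw [h3, ← div_eq_inv_mul, le_div_iff₀ he0]
      have : (1 + e * -(1 / ((N : ℝ) + 1))) * ((N : ℝ) + 1) ^ e
        = ((N : ℝ) + 1) ^ e - ((N : ℝ) + 1) ^ e / (N + 1) * e := by field_simp; ring
      linarith
    push_cast
    linarith

/-- The primes up to `N`. -/
abbrev primesUpTo (N : ℕ) : Finset ℕ := (Finset.range (N + 1)).filter Nat.Prime

theorem sum_primesUpTo_eq (N : ℕ) (g : ℕ → ℝ) :
    ∑ p ∈ primesUpTo N, g p =
      ∑ n ∈ Finset.range N, if (n + 1).Prime then g (n + 1) else 0 := by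
  rw [Finset.sum_filter, Finset.sum_range_succ', if_neg Nat.not_prime_zero, add_zero]

theorem sum_log_primesUpTo_le (N : ℕ) :
    ∑ p ∈ primesUpTo N, Real.log p ≤ Real.log 4 * N := by
  have h := Chebyshev.theta_le_log4_mul_x (x := (N : ℝ)) (Nat.cast_nonneg N)
  rw [Chebyshev.theta_eq_sum_Icc, Nat.floor_natCast] at h
  convert h using 2
  ext p; simp

theorem sum_log_mul_rpow_le {e : ℝ} (he0 : 0 < e) (he1 : e ≤ 1) (N : ℕ) :
    ∑ p ∈ primesUpTo N, Real.log p * (p : ℝ) ^ (e - 1) ≤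
      Real.log 4 * (e⁻¹ * (N : ℝ) ^ e) := by
  rw [sum_primesUpTo_eq N (fun p => Real.log p * (p : ℝ) ^ (e - 1))]
  have h := sum_mul_le_of_sum_le_of_antitone
    (a := fun n : ℕ => if (n + 1).Prime then Real.log (n + 1 : ℕ) else 0)
    (w := fun n : ℕ => ((n : ℝ) + 1) ^ (e - 1)) (c := Real.log 4) ?_ ?_ ?_ N
  · refine le_trans (le_of_eq ?_) (h.trans (mul_le_mul_of_nonneg_left
      (sum_rpow_sub_one_le he0 he1 N) (Real.log_nonneg (by norm_num))))
    refine Finset.sum_congr rfl fun n _ => ?_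
    split_ifs <;> simp
  · intro m n hmn
    exact Real.rpow_le_rpow_of_nonpos (by positivity) (by simpa using hmn) (by linarith)
  · intro n; positivity
  · intro N
    rw [← sum_primesUpTo_eq N (fun p => Real.log p)]
    exact sum_log_primesUpTo_le N

theorem exists_sum_rpow_le {s : ℝ} (hs : s < -1) :
    ∃ C : ℝ, 0 ≤ C ∧ ∀ T : Finset ℕ, ∑ p ∈ T, (p : ℝ) ^ s ≤ C :=
  ⟨∑' n : ℕ, (n : ℝ) ^ s, tsum_nonneg fun n => by positivity,
    fun T => (Real.summable_nat_rpow.2 hs).sum_le_tsum T fun n _ => by positivity⟩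

theorem log_le_four_mul_rpow {x : ℝ} (hx : 0 ≤ x) : Real.log x ≤ 4 * x ^ (1 / 4 : ℝ) := by
  have := Real.log_le_rpow_div hx (show (0 : ℝ) < 1 / 4 by norm_num)
  linarith

theorem abs_log_div_sub_log_div_le {p : ℕ} (hp : p.Prime) :
    |Real.log p / ((p : ℝ) - 1) - Real.log p / p| ≤ 8 * (p : ℝ) ^ (-(3 / 2) : ℝ) := by
  have h2 : (2 : ℝ) ≤ p := by exact_mod_cast hp.two_le
  have h0 : (0 : ℝ) < p := by linarith
  have hl : 0 ≤ Real.log p := Real.log_nonneg (by linarith)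
  have e1 : Real.log p / ((p : ℝ) - 1) - Real.log p / p = Real.log p / ((p - 1) * p) := by
    have : (p : ℝ) - 1 ≠ 0 := by linarith
    field_simp; ring
  rw [e1, abs_of_nonneg (div_nonneg hl (mul_nonneg (by linarith) h0.le)),
    div_le_iff₀ (mul_pos (by linarith) h0)]
  have e2 : (p : ℝ) ^ (-(3 / 2) : ℝ) * (p * p) = (p : ℝ) ^ (1 / 2 : ℝ) := by
    rw [← sq, ← Real.rpow_natCast, ← Real.rpow_add h0]; norm_num
  have e3 : (p : ℝ) ^ (1 / 4 : ℝ) ≤ (p : ℝ) ^ (1 / 2 : ℝ) :=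
    Real.rpow_le_rpow_of_exponent_le (by linarith) (by norm_num)
  have e4 : 0 ≤ (p : ℝ) ^ (-(3 / 2) : ℝ) * p := by positivity
  nlinarith [log_le_four_mul_rpow h0.le, mul_le_mul_of_nonneg_left h2 e4]

section Box

variable {R : Type*} [CommRing R] {ι : Type*} [Fintype ι] (b : Module.Basis ι ℤ R)

/-- Coordinates of products are bounded in terms of the coordinates of the factors. -/
theorem exists_abs_repr_mul_le :
    ∃ L : ℕ, ∀ (x y : R) (A B : ℤ), 0 ≤ A → 0 ≤ B → (∀ i, |b.repr x i| ≤ A) →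
      (∀ i, |b.repr y i| ≤ B) → ∀ k, |b.repr (x * y) k| ≤ L * (A * B) := by
  refine ⟨∑ k, ∑ i, ∑ j, (b.repr (b i * b j) k).natAbs, fun x y A B hA hB hx hy k => ?_⟩
  have e : b.repr (x * y) k
      = ∑ i, ∑ j, b.repr x i * b.repr y j * b.repr (b i * b j) k := by
    conv_lhs => rw [← b.sum_repr x, ← b.sum_repr y]
    simp only [Finset.sum_mul_sum, map_sum, Finsupp.coe_finsetSum, Finset.sum_apply,
      smul_mul_smul_comm, map_smul, Finsupp.smul_apply, smul_eq_mul]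
  have h1 : |b.repr (x * y) k| ≤ ∑ i, ∑ j, A * B * |b.repr (b i * b j) k| := by
    rw [e]
    refine (Finset.abs_sum_le_sum_abs _ _).trans (Finset.sum_le_sum fun i _ => ?_)
    refine (Finset.abs_sum_le_sum_abs _ _).trans (Finset.sum_le_sum fun j _ => ?_)
    rw [abs_mul, abs_mul]
    exact mul_le_mul_of_nonneg_right (mul_le_mul (hx i) (hy j) (abs_nonneg _) hA) (abs_nonneg _)
  have h2 : ∑ i, ∑ j, A * B * |b.repr (b i * b j) k|
      = (∑ i, ∑ j, |b.repr (b i * b j) k|) * (A * B) := by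
    simp_rw [Finset.sum_mul, mul_comm]
  have h3 : ∑ i, ∑ j, |b.repr (b i * b j) k| ≤ ∑ k, ∑ i, ∑ j, |b.repr (b i * b j) k| :=
    Finset.single_le_sum (f := fun k => ∑ i, ∑ j, |b.repr (b i * b j) k|)
      (fun k _ => Finset.sum_nonneg fun i _ => Finset.sum_nonneg fun j _ => abs_nonneg _)
      (Finset.mem_univ k)
  push_cast
  rw [h2] at h1
  exact h1.trans (mul_le_mul_of_nonneg_right h3 (mul_nonneg hA hB))

/-- Every class modulo a nonzero ideal has a representative whose coordinates are of size
`O(m)`, where `m ^ d` is about the norm of the ideal. -/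
theorem exists_small_representative [IsDedekindDomain R] [Module.Free ℤ R] [Module.Finite ℤ R] :
    ∃ L : ℕ, ∀ (I : Ideal R) (m : ℕ), Ideal.absNorm I ≠ 0 →
      Ideal.absNorm I < (m + 1) ^ Fintype.card ι → ∀ a : R, ∃ δ : R, a - δ ∈ I ∧
        ∀ k, |b.repr δ k| ≤ (L * m : ℕ) := by
  obtain ⟨L, hL⟩ := exists_abs_repr_mul_le b
  refine ⟨L, fun I m hI hm a => ?_⟩
  have hfin : Finite (R ⧸ I) := (Ideal.absNorm_ne_zero_iff I).1 hI
  obtain ⟨u, v, huv, hne⟩ : ∃ u v : ι → Fin (m + 1),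
      Ideal.Quotient.mk I (∑ i, ((u i : ℕ) : ℤ) • b i)
        = Ideal.Quotient.mk I (∑ i, ((v i : ℕ) : ℤ) • b i) ∧ u ≠ v := by
    have : ¬ Function.Injective fun u : ι → Fin (m + 1) =>
        Ideal.Quotient.mk I (∑ i, ((u i : ℕ) : ℤ) • b i) := by
      intro hinj
      have := Nat.card_le_card_of_injective _ hinj
      rw [Nat.card_fun, Nat.card_fin, Nat.card_eq_fintype_card] at this
      rw [Ideal.absNorm_apply, Submodule.cardQuot_apply] at hm
      omega
    simpa [Function.Injective] using this
  set γ : R := ∑ i, (((u i : ℕ) : ℤ) - ((v i : ℕ) : ℤ)) • b i with hγ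
  have hγI : γ ∈ I := by
    rw [Ideal.Quotient.eq, ← Finset.sum_sub_distrib] at huv
    simpa [hγ, sub_smul] using huv
  have hγc : ∀ i, b.repr γ i = ((u i : ℕ) : ℤ) - ((v i : ℕ) : ℤ) := fun i => by
    rw [hγ, b.repr_sum_self]
  have hγb : ∀ i, |b.repr γ i| ≤ (m : ℤ) := fun i => by
    rw [hγc, abs_le]; constructor <;> have := (u i).2 <;> have := (v i).2 <;> omega
  have hγ0 : γ ≠ 0 := by
    intro h0
    apply hne
    ext i
    have := hγc i
    rw [h0] at this
    simp at this
    omega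
  set n : ℕ := Ideal.absNorm (Ideal.span {γ}) with hn
  have hn0 : n ≠ 0 := by
    have hq : Ideal.span {γ} ≠ ⊥ := by simpa using hγ0
    rwa [hn, Ne, Ideal.absNorm_eq_zero_iff]
  obtain ⟨γ', hγ'⟩ := Ideal.mem_span_singleton'.1 (Ideal.absNorm_mem (Ideal.span {γ}))
  rw [← hn] at hγ'
  set c : R := a * γ' with hc
  set q : R := ∑ i, (b.repr c i / n) • b i with hq
  set s : R := ∑ i, (b.repr c i % n) • b i with hs
  have hqs : c = (n : ℤ) • q + s := by
    rw [hq, hs, Finset.smul_sum, ← Finset.sum_add_distrib]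
    conv_lhs => rw [← b.sum_repr c]
    refine Finset.sum_congr rfl fun i _ => ?_
    rw [smul_smul, ← add_smul, Int.mul_ediv_add_emod]
  have hδ : (n : ℤ) • (a - γ * q) = γ * s := by
    have : s = c - (n : ℤ) • q := by rw [hqs]; ring
    rw [this, hc]
    simp only [zsmul_eq_mul, Int.cast_natCast]
    linear_combination (-a) * hγ'
  have hsb : ∀ i, |b.repr s i| ≤ (n : ℤ) := fun i => by
    rw [hs, b.repr_sum_self, abs_of_nonneg (Int.emod_nonneg _ (by omega))]
    exact (Int.emod_lt_of_pos _ (by omega)).le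
  refine ⟨a - γ * q, by simpa using I.mul_mem_right q hγI, fun k => ?_⟩
  have h1 := hL γ s m n (by omega) (by omega) hγb hsb k
  rw [← hδ, map_smul, Finsupp.smul_apply, smul_eq_mul, abs_mul, Nat.abs_cast] at h1
  have h2 : (n : ℤ) * |b.repr (a - γ * q) k| ≤ n * (L * m) := by linarith
  push_cast
  exact le_of_mul_le_mul_left h2 (by omega)

variable [DecidableEq ι]

/-- The elements whose coordinates lie in the cube with corner `u` and side `X`. -/
noncomputable def box (u : ι → ℤ) (X : ℕ) : Finset R :=
  (Fintype.piFinset fun i => Finset.Ico (u i) (u i + X)).map b.equivFun.symm.toEquiv.toEmbedding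

theorem mem_box {u : ι → ℤ} {X : ℕ} {a : R} :
    a ∈ box b u X ↔ ∀ i, u i ≤ b.repr a i ∧ b.repr a i < u i + X := by
  rw [box, Finset.mem_map_equiv]
  simp

theorem card_box (u : ι → ℤ) (X : ℕ) : (box b u X).card = X ^ Fintype.card ι := by
  simp [box, Finset.card_map]

open Classical in
theorem card_box_ideal_bounds {I : Ideal R} [Finite (R ⧸ I)] {ρ : ℕ}
    (h : ∀ a : R, ∃ δ : R, a - δ ∈ I ∧ ∀ k, |b.repr δ k| ≤ (ρ : ℤ)) (u : ι → ℤ) (X : ℕ) :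
    (X - 2 * ρ) ^ Fintype.card ι ≤ ((box b u X).filter (· ∈ I)).card * Nat.card (R ⧸ I) ∧
    ((box b u X).filter (· ∈ I)).card * Nat.card (R ⧸ I) ≤ (X + 2 * ρ) ^ Fintype.card ι := by
  have := Fintype.ofFinite (R ⧸ I)
  have h' : ∀ q : R ⧸ I, ∃ δ : R, Ideal.Quotient.mk I δ = q ∧ ∀ k, |b.repr δ k| ≤ (ρ : ℤ) := by
    intro q
    obtain ⟨a, rfl⟩ := Ideal.Quotient.mk_surjective q
    obtain ⟨δ, h1, h2⟩ := h a
    exact ⟨δ, (Ideal.Quotient.eq.2 h1).symm, h2⟩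
  choose s hs hsb using h'
  rw [Nat.card_eq_fintype_card, show Fintype.card (R ⧸ I) = (Finset.univ : Finset (R ⧸ I)).card from rfl,
    ← Finset.card_product]
  constructor
  · rcases lt_or_ge X (2 * ρ) with hX | hX
    · rw [Nat.sub_eq_zero_of_le hX.le]
      rcases isEmpty_or_nonempty ι with hι | hι
      · have : (0 : R) ∈ (box b u X).filter (· ∈ I) := by simp [mem_box]
        rw [Fintype.card_eq_zero, pow_zero]
        exact Finset.card_pos.2 ⟨(0, 0), by simp [mem_box]⟩
      · simp
    rw [← card_box b (fun i => u i + ρ)]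
    apply Finset.card_le_card_of_surjOn (fun z : R × (R ⧸ I) => z.1 + s z.2)
    intro y hy
    simp only [Finset.mem_coe, mem_box] at hy
    refine ⟨(y - s (Ideal.Quotient.mk I y), Ideal.Quotient.mk I y), ?_, by simp⟩
    simp only [Finset.coe_product, Finset.coe_filter, Finset.coe_univ, Set.mem_prod,
      Set.mem_ofPred_eq, Set.mem_univ, and_true, mem_box]
    refine ⟨fun i => ?_, Ideal.Quotient.eq.1 (hs _).symm⟩
    have h1 := abs_le.1 (hsb (Ideal.Quotient.mk I y) i)
    have h2 := hy i
    simp only [map_sub, Finsupp.sub_apply]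
    omega
  · rw [← card_box b (fun i => u i - ρ)]
    apply Finset.card_le_card_of_injOn (fun z : R × (R ⧸ I) => z.1 + s z.2)
    · rintro ⟨x, q⟩ hx
      simp only [Finset.coe_product, Finset.coe_filter, Finset.coe_univ, Set.mem_prod,
        Set.mem_ofPred_eq, Set.mem_univ, and_true, mem_box] at hx
      simp only [Finset.mem_coe, mem_box]
      intro i
      have h1 := abs_le.1 (hsb q i)
      have h2 := hx.1 i
      simp only [map_add, Finsupp.add_apply]
      push_cast
      omega
    · rintro ⟨x, q⟩ hx ⟨x', q'⟩ hx' hxx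
      simp only [Finset.coe_product, Finset.coe_filter, Finset.coe_univ, Set.mem_prod,
        Set.mem_ofPred_eq, Set.mem_univ, and_true] at hx hx'
      have e : x + s q = x' + s q' := hxx
      have h3 := congrArg (Ideal.Quotient.mk I) e
      rw [map_add, map_add, hs, hs, Ideal.Quotient.eq_zero_iff_mem.2 hx.2,
        Ideal.Quotient.eq_zero_iff_mem.2 hx'.2, zero_add, zero_add] at h3
      subst h3
      simpa using e

end Box

open Module NumberField in
theorem card_chooseBasisIndex_eq_finrank (F : Type*) [Field F] [NumberField F] :
    Fintype.card (Free.ChooseBasisIndex ℤ (𝓞 F)) = finrank ℚ F := by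
  rw [← RingOfIntegers.rank F, finrank_eq_card_chooseBasisIndex]

open Module NumberField in
theorem absNorm_span_eq_prod_norm {F : Type*} [Field F] [NumberField F] (a : 𝓞 F) :
    (Ideal.absNorm (Ideal.span {a}) : ℝ) = ∏ φ : F →ₐ[ℚ] ℂ, ‖φ (a : F)‖ := by
  rw [Ideal.absNorm_span_singleton, ← norm_prod, ← Algebra.norm_eq_prod_embeddings,
    ← Algebra.coe_norm_int]
  simp [Nat.cast_natAbs]

open Module NumberField in
theorem pow_le_absNorm_span {F : Type*} [Field F] [NumberField F] {a : 𝓞 F} {A B : ℕ}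
    (h : ∀ φ : F →ₐ[ℚ] ℂ, (A : ℝ) ≤ ‖φ (a : F)‖ ∧ ‖φ (a : F)‖ ≤ B) :
    A ^ finrank ℚ F ≤ Ideal.absNorm (Ideal.span {a}) ∧
      Ideal.absNorm (Ideal.span {a}) ≤ B ^ finrank ℚ F := by
  have hc : (Finset.univ : Finset (F →ₐ[ℚ] ℂ)).card = finrank ℚ F := by
    rw [Finset.card_univ, AlgHom.card]
  have e := absNorm_span_eq_prod_norm a
  constructor
  · have := Finset.prod_le_prod (s := (Finset.univ : Finset (F →ₐ[ℚ] ℂ)))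
      (f := fun _ => (A : ℝ)) (fun φ _ => Nat.cast_nonneg A) (fun φ _ => (h φ).1)
    rw [Finset.prod_const, hc, ← e] at this
    exact_mod_cast this
  · have := Finset.prod_le_prod (s := (Finset.univ : Finset (F →ₐ[ℚ] ℂ)))
      (g := fun _ => (B : ℝ)) (fun φ _ => norm_nonneg _) (fun φ _ => (h φ).2)
    rw [Finset.prod_const, hc, ← e] at this
    exact_mod_cast this

open Module NumberField in
/-- Boxes of integers all of whose conjugates are of size `≍ X`. -/
theorem exists_box_norm_bounds (F : Type*) [Field F] [NumberField F]
    [DecidableEq (Free.ChooseBasisIndex ℤ (𝓞 F))] :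
    ∃ c : ℕ, 1 ≤ c ∧ ∀ X : ℕ, ∃ u : Free.ChooseBasisIndex ℤ (𝓞 F) → ℤ,
      ∀ a ∈ box (RingOfIntegers.basis F) u X,
        X ^ finrank ℚ F ≤ Ideal.absNorm (Ideal.span {a}) ∧
        Ideal.absNorm (Ideal.span {a}) ≤ (c * X) ^ finrank ℚ F := by
  set b := RingOfIntegers.basis F
  obtain ⟨M, hM⟩ := exists_nat_ge (∑ φ : F →ₐ[ℚ] ℂ, ∑ i, ‖φ (b i : F)‖)
  have hM' : ∀ φ : F →ₐ[ℚ] ℂ, ∑ i, ‖φ (b i : F)‖ ≤ M := fun φ =>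
    (Finset.single_le_sum (f := fun φ : F →ₐ[ℚ] ℂ => ∑ i, ‖φ (b i : F)‖)
      (fun φ _ => Finset.sum_nonneg fun i _ => norm_nonneg _) (Finset.mem_univ φ)).trans hM
  refine ⟨2 * M + 1, by omega, fun X => ⟨fun i => ((M + 1) * X : ℕ) * b.repr 1 i,
    fun a ha => pow_le_absNorm_span fun φ => ?_⟩⟩
  rw [mem_box] at ha
  set t : 𝓞 F := a - (((M + 1) * X : ℕ) : ℤ) • 1 with ht
  have htc : ∀ i, b.repr t i = b.repr a i - ((M + 1) * X : ℕ) * b.repr 1 i := fun i => by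
    rw [ht, map_sub, map_smul, Finsupp.sub_apply, Finsupp.smul_apply, smul_eq_mul]
  have htn : ‖φ (t : F)‖ ≤ M * X := by
    have e : φ (t : F) = ∑ i, ((b.repr t i : ℤ) : ℂ) * φ (b i : F) := by
      conv_lhs => rw [← b.sum_repr t]
      simp [map_sum]
    rw [e]
    refine (norm_sum_le _ _).trans ?_
    calc ∑ i, ‖((b.repr t i : ℤ) : ℂ) * φ (b i : F)‖
        ≤ ∑ i, X * ‖φ (b i : F)‖ := by
          refine Finset.sum_le_sum fun i _ => ?_
          rw [norm_mul]
          refine mul_le_mul_of_nonneg_right ?_ (norm_nonneg _)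
          rw [Complex.norm_intCast]
          have h1 := ha i
          have h2 : |b.repr t i| ≤ (X : ℤ) := by rw [htc, abs_le]; constructor <;> linarith
          exact_mod_cast h2
      _ ≤ M * X := by
          rw [← Finset.mul_sum, mul_comm]
          exact mul_le_mul_of_nonneg_right (hM' φ) (Nat.cast_nonneg _)
  have e : φ (a : F) = (((M + 1) * X : ℕ) : ℂ) + φ (t : F) := by
    rw [ht]
    simp
  have hn : ‖((((M + 1) * X : ℕ) : ℂ))‖ = (M + 1) * X := by
    rw [Complex.norm_natCast]; push_cast; ring
  rw [e]
  constructor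
  · have := norm_sub_le_norm_add ((((M + 1) * X : ℕ) : ℂ)) (φ (t : F))
    rw [hn] at this
    linarith
  · have := norm_add_le ((((M + 1) * X : ℕ) : ℂ)) (φ (t : F))
    rw [hn] at this
    push_cast at *
    linarith

theorem abs_sub_pow_le_of_bounds {d X ρ n A : ℕ} (hρ : X + 2 * ρ ≤ A * X)
    (h1 : (X - 2 * ρ) ^ d ≤ n) (h2 : n ≤ (X + 2 * ρ) ^ d) :
    |(n : ℝ) - (X : ℝ) ^ d| ≤ 2 * ρ * d * (A * X) ^ (d - 1) := by
  have h1' : (((X - 2 * ρ : ℕ) : ℝ)) ^ d ≤ n := by exact_mod_cast h1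
  have h2' : (n : ℝ) ≤ ((X : ℝ) + 2 * ρ) ^ d := by exact_mod_cast h2
  have hρ' : (X : ℝ) + 2 * ρ ≤ A * X := by exact_mod_cast hρ
  have hX0 : (0 : ℝ) ≤ X := Nat.cast_nonneg _
  have hρ0 : (0 : ℝ) ≤ ρ := Nat.cast_nonneg _
  have hA' : (X : ℝ) ≤ A * X := by linarith
  rw [abs_le]
  constructor
  · have := abs_pow_sub_pow_le (X : ℝ) ((X - 2 * ρ : ℕ) : ℝ) d
    have h3 : |(X : ℝ) - ((X - 2 * ρ : ℕ) : ℝ)| ≤ 2 * ρ := by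
      have h4 : ((X - 2 * ρ : ℕ) : ℝ) ≤ X := by exact_mod_cast Nat.sub_le _ _
      have h5 : (X : ℝ) ≤ ((X - 2 * ρ : ℕ) : ℝ) + 2 * ρ := by
        have : X ≤ (X - 2 * ρ) + 2 * ρ := by omega
        exact_mod_cast this
      rw [abs_of_nonneg] <;> linarith
    have h6 : max |(X : ℝ)| |((X - 2 * ρ : ℕ) : ℝ)| ≤ A * X := by
      rw [abs_of_nonneg hX0, abs_of_nonneg (Nat.cast_nonneg _)]
      refine max_le hA' (le_trans ?_ hA')
      exact_mod_cast Nat.sub_le _ _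
    have h7 := le_abs_self ((X : ℝ) ^ d - ((X - 2 * ρ : ℕ) : ℝ) ^ d)
    have h8 : |(X : ℝ) - ((X - 2 * ρ : ℕ) : ℝ)| * d *
        max |(X : ℝ)| |((X - 2 * ρ : ℕ) : ℝ)| ^ (d - 1) ≤ 2 * ρ * d * (A * X) ^ (d - 1) := by
      gcongr
    linarith
  · have := abs_pow_sub_pow_le ((X : ℝ) + 2 * ρ) (X : ℝ) d
    have h3 : |(X : ℝ) + 2 * ρ - X| ≤ 2 * ρ := by
      rw [abs_of_nonneg] <;> linarith
    have h6 : max |(X : ℝ) + 2 * ρ| |(X : ℝ)| ≤ A * X := by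
      rw [abs_of_nonneg hX0, abs_of_nonneg (by positivity)]
      exact max_le hρ' hA'
    have h7 := le_abs_self (((X : ℝ) + 2 * ρ) ^ d - (X : ℝ) ^ d)
    have h8 : |(X : ℝ) + 2 * ρ - X| * d *
        max |(X : ℝ) + 2 * ρ| |(X : ℝ)| ^ (d - 1) ≤ 2 * ρ * d * (A * X) ^ (d - 1) := by
      gcongr
    linarith

open Module NumberField in
open Classical in
/-- Sets of `X ^ d` integers of norm `≍ X ^ d` which are equidistributed modulo ideals. -/
theorem exists_equidistributed_sets (F : Type*) [Field F] [NumberField F] :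
    ∃ (c : ℕ) (C : ℝ), 1 ≤ c ∧ 0 ≤ C ∧ ∀ X : ℕ, ∃ B : Finset (𝓞 F),
      B.card = X ^ finrank ℚ F ∧
      (∀ a ∈ B, X ^ finrank ℚ F ≤ Ideal.absNorm (Ideal.span {a}) ∧
        Ideal.absNorm (Ideal.span {a}) ≤ (c * X) ^ finrank ℚ F) ∧
      ∀ I : Ideal (𝓞 F), Ideal.absNorm I ≠ 0 → Ideal.absNorm I ≤ (c * X) ^ finrank ℚ F →
        |((B.filter (· ∈ I)).card : ℝ) * Ideal.absNorm I - (X : ℝ) ^ finrank ℚ F| ≤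
          C * (Ideal.absNorm I : ℝ) ^ ((finrank ℚ F : ℝ)⁻¹) * (X : ℝ) ^ (finrank ℚ F - 1) := by
  obtain ⟨c, hc, hbox⟩ := exists_box_norm_bounds F
  obtain ⟨L, hL⟩ := exists_small_representative (RingOfIntegers.basis F)
  have hcard := card_chooseBasisIndex_eq_finrank F
  have hd : 0 < finrank ℚ F := finrank_pos
  set d := finrank ℚ F
  have hd' : (0 : ℝ) < d := by exact_mod_cast hd
  refine ⟨c, 2 * L * d * ((1 + 2 * (L * c) : ℕ) : ℝ) ^ (d - 1), hc, by positivity, fun X => ?_⟩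
  obtain ⟨u, hu⟩ := hbox X
  refine ⟨box (RingOfIntegers.basis F) u X, by rw [card_box, hcard], hu, fun I hI hIX => ?_⟩
  have := (Ideal.absNorm_ne_zero_iff I).1 hI
  set n := Ideal.absNorm I with hn
  set r : ℝ := (n : ℝ) ^ (d : ℝ)⁻¹ with hr
  have hr0 : 0 ≤ r := by positivity
  have hrd : r ^ d = n := Real.rpow_inv_natCast_pow (Nat.cast_nonneg n) hd.ne'
  have hm1 : n < (⌊r⌋₊ + 1) ^ d := by
    have : (n : ℝ) < ((⌊r⌋₊ : ℝ) + 1) ^ d := by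
      rw [← hrd]
      exact pow_lt_pow_left₀ (Nat.lt_floor_add_one r) hr0 hd.ne'
    exact_mod_cast this
  have hm2 : (⌊r⌋₊ : ℝ) ≤ r := Nat.floor_le hr0
  have hm3 : ⌊r⌋₊ ≤ c * X := by
    have : (⌊r⌋₊ : ℝ) ^ d ≤ ((c * X : ℕ) : ℝ) ^ d := by
      refine (pow_le_pow_left₀ (Nat.cast_nonneg _) hm2 d).trans ?_
      rw [hrd]
      exact_mod_cast hIX
    have := (pow_le_pow_iff_left₀ (Nat.cast_nonneg _) (Nat.cast_nonneg _) hd.ne').1 this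
    exact_mod_cast this
  obtain ⟨h1, h2⟩ := card_box_ideal_bounds (RingOfIntegers.basis F)
    (hL I ⌊r⌋₊ hI (by rw [hcard]; exact hm1)) u X
  rw [hcard] at h1 h2
  have h3 := abs_sub_pow_le_of_bounds (A := 1 + 2 * (L * c)) (by nlinarith) h1 h2
  have hcq : (Nat.card (𝓞 F ⧸ I)) = n := by rw [hn, Ideal.absNorm_apply, Submodule.cardQuot_apply]
  rw [hcq] at h3
  push_cast at h3
  refine h3.trans ?_
  rw [mul_pow]
  push_cast
  calc 2 * ((L : ℝ) * (⌊r⌋₊ : ℝ)) * d * ((1 + 2 * ((L : ℝ) * c)) ^ (d - 1) * (X : ℝ) ^ (d - 1))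
      ≤ 2 * ((L : ℝ) * r) * d * ((1 + 2 * ((L : ℝ) * c)) ^ (d - 1) * (X : ℝ) ^ (d - 1)) := by
        gcongr
    _ = _ := by ring

open NumberField in
open Classical in
/-- The nonzero prime ideals of norm at most `Y`. -/
noncomputable def primeIdealsUpTo (F : Type*) [Field F] [NumberField F] (Y : ℕ) :
    Finset (Ideal (𝓞 F)) :=
  (Ideal.finite_setOfPred_absNorm_le (S := 𝓞 F) Y).toFinset.filter fun P => P.IsPrime ∧ P ≠ ⊥

open NumberField in
theorem mem_primeIdealsUpTo {F : Type*} [Field F] [NumberField F] {Y : ℕ} {P : Ideal (𝓞 F)} :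
    P ∈ primeIdealsUpTo F Y ↔ Ideal.absNorm P ≤ Y ∧ P.IsPrime ∧ P ≠ ⊥ := by
  simp [primeIdealsUpTo]

open NumberField in
theorem two_le_absNorm {F : Type*} [Field F] [NumberField F] {P : Ideal (𝓞 F)}
    (hP : P.IsPrime) (h0 : P ≠ ⊥) : 2 ≤ Ideal.absNorm P := by
  have h1 : Ideal.absNorm P ≠ 0 := by rwa [Ne, Ideal.absNorm_eq_zero_iff]
  have h2 : Ideal.absNorm P ≠ 1 := by rw [Ne, Ideal.absNorm_eq_one_iff]; exact hP.ne_top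
  omega

open NumberField UniqueFactorizationMonoid in
open Classical in
theorem le_pow_iff_le_count {F : Type*} [Field F] [NumberField F] {P J : Ideal (𝓞 F)}
    (hP : P.IsPrime) (h0 : P ≠ ⊥) (hJ : J ≠ ⊥) (k : ℕ) :
    J ≤ P ^ k ↔ k ≤ (normalizedFactors J).count P := by
  have hirr : Irreducible P := ((Ideal.prime_iff_isPrime h0).2 hP).irreducible
  rw [← Ideal.dvd_iff_le, pow_dvd_iff_le_emultiplicity,
    emultiplicity_eq_count_normalizedFactors hirr hJ, normalize_eq]
  exact Nat.cast_le

open NumberField UniqueFactorizationMonoid in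
open Classical in
theorem log_absNorm_eq_sum {F : Type*} [Field F] [NumberField F] {J : Ideal (𝓞 F)}
    (hJ : J ≠ ⊥) {Y : ℕ} (hY : Ideal.absNorm J ≤ Y) :
    Real.log (Ideal.absNorm J) = ∑ P ∈ primeIdealsUpTo F Y, ∑ k ∈ Finset.range Y,
      if J ≤ P ^ (k + 1) then Real.log (Ideal.absNorm P) else 0 := by
  have hJ0 : Ideal.absNorm J ≠ 0 := by rwa [Ne, Ideal.absNorm_eq_zero_iff]
  have hnf : ∀ P ∈ normalizedFactors J, P.IsPrime ∧ P ≠ ⊥ := fun P hP => by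
    have := prime_of_normalized_factor P hP
    exact ⟨Ideal.isPrime_of_prime this, this.ne_zero⟩
  have h1 : ∀ P ∈ primeIdealsUpTo F Y, (∑ k ∈ Finset.range Y,
      if J ≤ P ^ (k + 1) then Real.log (Ideal.absNorm P) else 0) =
      (normalizedFactors J).count P * Real.log (Ideal.absNorm P) := by
    intro P hP
    obtain ⟨-, hp, hp0⟩ := mem_primeIdealsUpTo.1 hP
    have hc : (normalizedFactors J).count P ≤ Y := by
      have := (le_pow_iff_le_count hp hp0 hJ _).2 le_rfl
      have h2 := Nat.le_of_dvd (Nat.pos_of_ne_zero hJ0) (Ideal.absNorm_dvd_absNorm_of_le this)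
      rw [map_pow] at h2
      exact (Nat.lt_pow_self (two_le_absNorm hp hp0)).le.trans (h2.trans hY)
    rw [← Finset.sum_filter, Finset.sum_const, nsmul_eq_mul]
    congr 2
    rw [← Finset.card_range ((normalizedFactors J).count P)]
    congr 1
    ext k
    rw [Finset.mem_filter, Finset.mem_range, Finset.mem_range,
      le_pow_iff_le_count hp hp0 hJ]
    omega
  rw [Finset.sum_congr rfl h1]
  have h2 : Real.log (Ideal.absNorm J) =
      ((normalizedFactors J).map fun P => Real.log (Ideal.absNorm P)).sum := by
    conv_lhs => rw [← Ideal.prod_normalizedFactors_eq_self hJ]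
    rw [map_multiset_prod]
    have : ∀ s : Multiset (Ideal (𝓞 F)), (∀ P ∈ s, P.IsPrime ∧ P ≠ ⊥) →
        Real.log ((s.map Ideal.absNorm).prod : ℕ) =
          (s.map fun P => Real.log (Ideal.absNorm P)).sum := by
      intro s
      induction s using Multiset.induction with
      | empty => simp
      | cons P s ih =>
        intro h
        have hp := h P (by simp)
        have := two_le_absNorm hp.1 hp.2
        have h3 : (s.map (Ideal.absNorm (S := 𝓞 F))).prod ≠ 0 := by
          refine Multiset.prod_ne_zero fun h0 => ?_
          obtain ⟨Q, hQ, hQ0⟩ := Multiset.mem_map.1 h0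
          have hq := h Q (by simp [hQ])
          have := two_le_absNorm hq.1 hq.2
          omega
        rw [Multiset.map_cons, Multiset.prod_cons, Multiset.map_cons, Multiset.sum_cons,
          Nat.cast_mul, Real.log_mul (by positivity) (by exact_mod_cast h3),
          ih fun Q hQ => h Q (by simp [hQ])]
    exact this _ hnf
  rw [h2, Finset.sum_multiset_map_count]
  simp_rw [nsmul_eq_mul]
  refine Finset.sum_subset (fun P hP => ?_) fun P _ hP => ?_
  · rw [Multiset.mem_toFinset] at hP
    refine mem_primeIdealsUpTo.2 ⟨le_trans (Nat.le_of_dvd (Nat.pos_of_ne_zero hJ0)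
      (Ideal.absNorm_dvd_absNorm_of_le ?_)) hY, hnf P hP⟩
    exact Ideal.le_of_dvd (dvd_of_mem_normalizedFactors hP)
  · rw [Multiset.mem_toFinset] at hP
    rw [Multiset.count_eq_zero_of_notMem hP]; simp

open NumberField Module in
/-- At most `[F : ℚ]` primes lie above `p`. -/
theorem card_le_finrank_of_mem {F : Type*} [Field F] [NumberField F] {p : ℕ} (hp : p.Prime)
    (S : Finset (Ideal (𝓞 F))) (hS : ∀ P ∈ S, P.IsPrime ∧ P ≠ ⊥ ∧ (p : 𝓞 F) ∈ P) :
    S.card ≤ finrank ℚ F := by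
  have h1 : ∏ P ∈ S, P ∣ Ideal.span {(p : 𝓞 F)} := by
    refine Finset.prod_primes_dvd _ (fun P hP => ?_) fun P hP => ?_
    · exact (Ideal.prime_iff_isPrime (hS P hP).2.1).2 (hS P hP).1
    · rw [Ideal.dvd_span_singleton]; exact (hS P hP).2.2
  have h2 := map_dvd (Ideal.absNorm (S := 𝓞 F)) h1
  rw [map_prod, Ideal.absNorm_span_natCast, RingOfIntegers.rank] at h2
  have h3 : p ^ S.card ≤ ∏ P ∈ S, Ideal.absNorm P := by
    refine Finset.pow_card_le_prod _ _ _ fun P hP => ?_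
    obtain ⟨hP1, hP0, hpP⟩ := hS P hP
    have h4 := Ideal.absNorm_dvd_absNorm_of_le
      ((Ideal.span_singleton_le_iff_mem P).2 hpP)
    rw [Ideal.absNorm_span_natCast] at h4
    obtain ⟨k, -, hk⟩ := (Nat.dvd_prime_pow hp).1 h4
    have := two_le_absNorm hP1 hP0
    rcases k with _ | k
    · rw [hk, pow_zero] at this; omega
    · rw [hk]; exact Nat.le_self_pow (by omega) p
  exact (Nat.pow_le_pow_iff_right hp.one_lt).1
    (h3.trans (Nat.le_of_dvd (by have := hp.pos; positivity) h2))

theorem sum_inv_pow_le {x : ℝ} (hx : 2 ≤ x) (Y : ℕ) :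
    ∑ k ∈ Finset.range Y, (x ^ (k + 1))⁻¹ ≤ 2 / x := by
  have h0 : 0 < x := by linarith
  have h : ∀ Y : ℕ, ∑ k ∈ Finset.range Y, (x ^ (k + 1))⁻¹ + (x ^ Y)⁻¹ * (2 / x) ≤ 2 / x := by
    intro Y
    induction Y with
    | zero => simp
    | succ Y ih =>
      rw [Finset.sum_range_succ]
      have h1 : (x ^ (Y + 1))⁻¹ + (x ^ (Y + 1))⁻¹ * (2 / x) ≤ (x ^ Y)⁻¹ * (2 / x) := by
        have : (x ^ Y)⁻¹ * (2 / x) - ((x ^ (Y + 1))⁻¹ + (x ^ (Y + 1))⁻¹ * (2 / x)) =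
          (x ^ (Y + 1))⁻¹ * ((x - 2) / x) := by field_simp; ring
        have : 0 ≤ (x ^ (Y + 1))⁻¹ * ((x - 2) / x) := by
          have : 0 ≤ x - 2 := by linarith
          positivity
        linarith
      linarith
  have := h Y
  have : 0 ≤ (x ^ Y)⁻¹ * (2 / x) := by positivity
  linarith [h Y]

theorem sum_log_div_pow_le {n : ℕ} (hn : 2 ≤ n) (Y : ℕ) :
    (∑ k ∈ Finset.range Y, if k = 0 ∧ n.Prime then 0 else Real.log n / (n : ℝ) ^ (k + 1)) ≤
      8 * (n.minFac : ℝ) ^ (-(3 / 2) : ℝ) := by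
  have hn' : (2 : ℝ) ≤ n := by exact_mod_cast hn
  have hn0 : (0 : ℝ) < n := by linarith
  have hl : 0 ≤ Real.log n := Real.log_nonneg (by linarith)
  have hl4 := log_le_four_mul_rpow hn0.le
  by_cases hp : n.Prime
  · rw [hp.minFac_eq]
    have h1 : (∑ k ∈ Finset.range Y,
        if k = 0 ∧ n.Prime then 0 else Real.log n / (n : ℝ) ^ (k + 1)) ≤
        Real.log n * (n : ℝ)⁻¹ * (2 / n) := by
      rcases Y with _ | Y
      · simp; positivity
      · rw [Finset.sum_range_succ']
        simp only [hp, and_true, if_true, add_zero, Nat.add_eq_zero_iff, one_ne_zero, and_false,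
          if_false]
        refine le_trans (le_of_eq ?_) (mul_le_mul_of_nonneg_left (sum_inv_pow_le hn' Y)
          (by positivity))
        rw [Finset.mul_sum]
        refine Finset.sum_congr rfl fun k _ => ?_
        field_simp
        ring
    have h2 : (n : ℝ) ^ (1 / 4 : ℝ) * ((n : ℝ)⁻¹ * (n : ℝ)⁻¹) ≤ (n : ℝ) ^ (-(3 / 2) : ℝ) := by
      rw [← Real.rpow_neg_one, ← Real.rpow_add hn0, ← Real.rpow_add hn0]
      exact Real.rpow_le_rpow_of_exponent_le (by linarith) (by norm_num)
    have h3 : 0 ≤ (n : ℝ)⁻¹ * (n : ℝ)⁻¹ := by positivity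
    have h4 := mul_le_mul_of_nonneg_right hl4 h3
    have h5 : Real.log n * (n : ℝ)⁻¹ * (2 / n) = 2 * (Real.log n * ((n : ℝ)⁻¹ * (n : ℝ)⁻¹)) := by
      ring
    linarith
  · simp only [hp, and_false, if_false]
    have h1 : ∑ k ∈ Finset.range Y, Real.log n / (n : ℝ) ^ (k + 1) ≤ Real.log n * (2 / n) := by
      simp_rw [div_eq_mul_inv (Real.log n)]
      rw [← Finset.mul_sum]
      exact mul_le_mul_of_nonneg_left (sum_inv_pow_le hn' Y) hl
    have h2 : (n : ℝ) ^ (1 / 4 : ℝ) * (n : ℝ)⁻¹ = (n : ℝ) ^ (-(3 / 4) : ℝ) := by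
      rw [← Real.rpow_neg_one, ← Real.rpow_add hn0]; norm_num
    have hq : (n.minFac : ℝ) ^ 2 ≤ n := by
      exact_mod_cast Nat.minFac_sq_le_self (by omega) hp
    have hq0 : (0 : ℝ) < n.minFac := by exact_mod_cast n.minFac_pos
    have h3 : (n : ℝ) ^ (-(3 / 4) : ℝ) ≤ (n.minFac : ℝ) ^ (-(3 / 2) : ℝ) := by
      refine (Real.rpow_le_rpow_of_nonpos (by positivity) hq (by norm_num)).trans (le_of_eq ?_)
      rw [← Real.rpow_natCast, ← Real.rpow_mul hq0.le]; norm_num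
    have h4 := mul_le_mul_of_nonneg_right hl4 (inv_nonneg.2 hn0.le)
    have h5 : Real.log n * (2 / n) = 2 * (Real.log n * (n : ℝ)⁻¹) := by ring
    nlinarith

open NumberField in
theorem minFac_absNorm_mem {F : Type*} [Field F] [NumberField F] {P : Ideal (𝓞 F)}
    (hP : P.IsPrime) (h0 : P ≠ ⊥) : ((Ideal.absNorm P).minFac : 𝓞 F) ∈ P := by
  have := hP.isMaximal h0
  obtain ⟨p, n, hn, hpP, hp, hN⟩ := Ideal.exists_prime_and_absNorm_eq_pow P
  rw [hN, Nat.pow_minFac hn.ne', hp.minFac_eq]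
  exact_mod_cast hpP

open NumberField Module in
theorem exists_sum_primeIdeals_tail_le (F : Type*) [Field F] [NumberField F] :
    ∃ C : ℝ, 0 ≤ C ∧ ∀ Y : ℕ, (∑ P ∈ primeIdealsUpTo F Y, ∑ k ∈ Finset.range Y,
      if k = 0 ∧ (Ideal.absNorm P).Prime then 0 else
        Real.log (Ideal.absNorm P) / (Ideal.absNorm P : ℝ) ^ (k + 1)) ≤ C := by
  obtain ⟨C, hC, h⟩ := exists_sum_rpow_le (s := -(3 / 2)) (by norm_num)
  refine ⟨finrank ℚ F * (8 * C), by positivity, fun Y => ?_⟩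
  classical
  calc _ ≤ ∑ P ∈ primeIdealsUpTo F Y, 8 * ((Ideal.absNorm P).minFac : ℝ) ^ (-(3 / 2) : ℝ) :=
        Finset.sum_le_sum fun P hP => by
          obtain ⟨-, hp, hp0⟩ := mem_primeIdealsUpTo.1 hP
          exact sum_log_div_pow_le (two_le_absNorm hp hp0) Y
    _ = ∑ q ∈ (primeIdealsUpTo F Y).image fun P => (Ideal.absNorm P).minFac,
          ∑ P ∈ (primeIdealsUpTo F Y) with (Ideal.absNorm P).minFac = q,
            8 * ((Ideal.absNorm P).minFac : ℝ) ^ (-(3 / 2) : ℝ) :=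
        (Finset.sum_fiberwise_of_maps_to (fun P hP => Finset.mem_image_of_mem _ hP) _).symm
    _ ≤ ∑ q ∈ (primeIdealsUpTo F Y).image fun P => (Ideal.absNorm P).minFac,
          finrank ℚ F * (8 * (q : ℝ) ^ (-(3 / 2) : ℝ)) := by
        refine Finset.sum_le_sum fun q hq => ?_
        obtain ⟨P₀, hP₀, rfl⟩ := Finset.mem_image.1 hq
        obtain ⟨-, hp, hp0⟩ := mem_primeIdealsUpTo.1 hP₀
        rw [Finset.sum_congr rfl (g := fun _ =>
          8 * ((Ideal.absNorm P₀).minFac : ℝ) ^ (-(3 / 2) : ℝ)) fun P hP => by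
            rw [(Finset.mem_filter.1 hP).2], Finset.sum_const, nsmul_eq_mul]
        gcongr
        refine card_le_finrank_of_mem
          (Nat.minFac_prime (n := Ideal.absNorm P₀) (by have := two_le_absNorm hp hp0; omega)) _
          fun P hP => ?_
        obtain ⟨hP, hPq⟩ := Finset.mem_filter.1 hP
        obtain ⟨-, hp', hp0'⟩ := mem_primeIdealsUpTo.1 hP
        exact ⟨hp', hp0', hPq ▸ minFac_absNorm_mem hp' hp0'⟩
    _ ≤ _ := by
        rw [← Finset.mul_sum, ← Finset.mul_sum]
        gcongr
        exact h _

open NumberField in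
/-- The number of (automatically prime) ideals of prime norm `p`. -/
noncomputable def degreeOneCount (F : Type*) [Field F] [NumberField F] (p : ℕ) : ℕ :=
  Nat.card {I : Ideal (𝓞 F) // Ideal.absNorm I = p}

open NumberField in
open Classical in
theorem degreeOneCount_eq_card (F : Type*) [Field F] [NumberField F] {p Y : ℕ} (hp : p.Prime)
    (hY : p ≤ Y) :
    degreeOneCount F p = ((primeIdealsUpTo F Y).filter fun P => Ideal.absNorm P = p).card := by
  refine Nat.subtype_card _ fun P => ?_
  rw [Finset.mem_filter, mem_primeIdealsUpTo]
  refine ⟨fun h => h.2, fun h => ⟨⟨h ▸ hY, ?_, ?_⟩, h⟩⟩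
  · exact Ideal.isPrime_of_irreducible_absNorm (h ▸ hp)
  · rintro rfl
    rw [Ideal.absNorm_bot] at h
    exact hp.ne_zero h.symm

open NumberField in
open Classical in
theorem sum_primeIdeals_primeNorm_eq (F : Type*) [Field F] [NumberField F] (Y : ℕ) (w : ℕ → ℝ) :
    ∑ P ∈ primeIdealsUpTo F Y with (Ideal.absNorm P).Prime, w (Ideal.absNorm P) =
      ∑ p ∈ primesUpTo Y, degreeOneCount F p * w p := by
  rw [← Finset.sum_fiberwise_of_maps_to (t := primesUpTo Y) (g := Ideal.absNorm)]
  · refine Finset.sum_congr rfl fun p hp => ?_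
    obtain ⟨hpY, hp⟩ := Finset.mem_filter.1 hp
    rw [Finset.sum_congr rfl (g := fun _ => w p) fun P hP => by
        rw [(Finset.mem_filter.1 hP).2], Finset.sum_const, nsmul_eq_mul,
      degreeOneCount_eq_card F hp (Nat.lt_succ_iff.1 (Finset.mem_range.1 hpY))]
    congr 3
    ext P
    simp only [Finset.mem_filter]
    exact ⟨fun h => ⟨h.1.1, h.2⟩, fun h => ⟨⟨h.1, h.2 ▸ hp⟩, h.2⟩⟩
  · intro P hP
    obtain ⟨h1, h2⟩ := Finset.mem_filter.1 hP
    have := (mem_primeIdealsUpTo.1 h1).1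
    simp only [Finset.mem_filter, Finset.mem_range]
    exact ⟨by omega, h2⟩

open NumberField Module in
theorem degreeOneCount_le (F : Type*) [Field F] [NumberField F] {p : ℕ} (hp : p.Prime) :
    degreeOneCount F p ≤ finrank ℚ F := by
  classical
  rw [degreeOneCount_eq_card F hp le_rfl]
  refine card_le_finrank_of_mem hp _ fun P hP => ?_
  obtain ⟨h1, h2⟩ := Finset.mem_filter.1 hP
  obtain ⟨-, h3, h4⟩ := mem_primeIdealsUpTo.1 h1
  exact ⟨h3, h4, h2 ▸ Ideal.absNorm_mem P⟩

open NumberField Module in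
open Classical in
theorem sum_log_absNorm_eq {F : Type*} [Field F] [NumberField F] {Y : ℕ} {B : Finset (𝓞 F)}
    (h0 : ∀ a ∈ B, a ≠ 0) (hY : ∀ a ∈ B, Ideal.absNorm (Ideal.span {a}) ≤ Y) :
    ∑ a ∈ B, Real.log (Ideal.absNorm (Ideal.span {a})) =
      ∑ P ∈ primeIdealsUpTo F Y, ∑ k ∈ Finset.range Y,
        Real.log (Ideal.absNorm P) * ((B.filter (· ∈ P ^ (k + 1))).card : ℝ) := by
  have h1 : ∀ a ∈ B, Real.log (Ideal.absNorm (Ideal.span {a})) =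
      ∑ P ∈ primeIdealsUpTo F Y, ∑ k ∈ Finset.range Y,
        if a ∈ P ^ (k + 1) then Real.log (Ideal.absNorm P) else 0 := by
    intro a ha
    rw [log_absNorm_eq_sum (by simpa using h0 a ha) (hY a ha)]
    simp_rw [Ideal.span_singleton_le_iff_mem]
  rw [Finset.sum_congr rfl h1, Finset.sum_comm]
  refine Finset.sum_congr rfl fun P _ => ?_
  rw [Finset.sum_comm]
  refine Finset.sum_congr rfl fun k _ => ?_
  rw [← Finset.sum_filter, Finset.sum_const, nsmul_eq_mul, mul_comm]

open NumberField Module in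
open Classical in
theorem exists_abs_sum_degreeOneCount_sub_log_pow_le (F : Type*) [Field F] [NumberField F] :
    ∃ (c : ℕ) (C : ℝ), 1 ≤ c ∧ 0 ≤ C ∧ ∀ X : ℕ, 1 ≤ X →
      |∑ p ∈ primesUpTo ((c * X) ^ finrank ℚ F), degreeOneCount F p * (Real.log p / p) -
        Real.log (((c * X) ^ finrank ℚ F : ℕ) : ℝ)| ≤ C := by
  obtain ⟨c, C, hc, hC, hB⟩ := exists_equidistributed_sets F
  obtain ⟨D, hD, htail⟩ := exists_sum_primeIdeals_tail_le F
  have hd : 0 < finrank ℚ F := finrank_pos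
  set d := finrank ℚ F with hd_def
  have hd' : (0 : ℝ) < d := by exact_mod_cast hd
  have hd1 : (1 : ℝ) ≤ d := by exact_mod_cast hd
  refine ⟨c, d * Real.log c + (1 + C * c) * D + C * (d * (Real.log 4 * (d * c))), hc,
    by positivity, fun X hX => ?_⟩
  obtain ⟨B, hcard, hnorm, hequi⟩ := hB X
  set Y := (c * X) ^ d with hY_def
  have hX' : (0 : ℝ) < X := by exact_mod_cast hX
  have hc' : (0 : ℝ) < c := by exact_mod_cast hc
  have hY1 : 1 ≤ Y := Nat.one_le_pow _ _ (Nat.mul_pos hc hX)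
  have hXd : (0 : ℝ) < (X : ℝ) ^ d := by positivity
  have hXd1 : (X : ℝ) * (X : ℝ) ^ (d - 1) = (X : ℝ) ^ d := by
    rw [← pow_succ', Nat.sub_add_cancel hd]
  have hYd : (Y : ℝ) ^ (d : ℝ)⁻¹ = c * X := by
    rw [hY_def]; push_cast
    exact Real.pow_rpow_inv_natCast (by positivity) hd.ne'
  have h0 : ∀ a ∈ B, a ≠ 0 := by
    rintro a ha rfl
    have := (hnorm 0 ha).1
    have h2 : 0 < X ^ d := Nat.pow_pos hX
    simp at this
    omega
  have hT := sum_log_absNorm_eq h0 fun a ha => (hnorm a ha).2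
  set T := ∑ a ∈ B, Real.log (Ideal.absNorm (Ideal.span {a}))
  have hTl : (X : ℝ) ^ d * (d * Real.log X) ≤ T := by
    have := Finset.card_nsmul_le_sum B (fun a => Real.log (Ideal.absNorm (Ideal.span {a})))
      (d * Real.log X) fun a ha => by
        rw [← Real.log_pow]
        exact Real.log_le_log hXd (by exact_mod_cast (hnorm a ha).1)
    rwa [nsmul_eq_mul, hcard, Nat.cast_pow] at this
  have hTu : T ≤ (X : ℝ) ^ d * (d * Real.log (c * X)) := by
    have := Finset.sum_le_card_nsmul B (fun a => Real.log (Ideal.absNorm (Ideal.span {a})))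
      (d * Real.log (c * X)) fun a ha => by
        rw [← Real.log_pow]
        refine Real.log_le_log ?_ (by exact_mod_cast (hnorm a ha).2)
        have := (hnorm a ha).1
        have h2 : 0 < X ^ d := Nat.pow_pos hX
        exact_mod_cast h2.trans_le this
    rwa [nsmul_eq_mul, hcard, Nat.cast_pow] at this
  -- the contribution of prime powers of non-prime norm
  have hterm : ∀ P ∈ primeIdealsUpTo F Y, ∀ k,
      Real.log (Ideal.absNorm P) * ((B.filter (· ∈ P ^ (k + 1))).card : ℝ) ≤
        (1 + C * c) * X ^ d * (Real.log (Ideal.absNorm P) / (Ideal.absNorm P : ℝ) ^ (k + 1)) := by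
    intro P hP k
    obtain ⟨-, hp, hp0⟩ := mem_primeIdealsUpTo.1 hP
    have h2 := two_le_absNorm hp hp0
    have h2' : (0 : ℝ) < Ideal.absNorm P := by exact_mod_cast (by omega : 0 < Ideal.absNorm P)
    have hl : 0 ≤ Real.log (Ideal.absNorm P) := Real.log_natCast_nonneg _
    by_cases hle : Ideal.absNorm (P ^ (k + 1)) ≤ Y
    · have hne : Ideal.absNorm (P ^ (k + 1)) ≠ 0 := by
        rw [map_pow]; exact pow_ne_zero _ (by omega)
      have h3 := (abs_le.1 (hequi _ hne hle)).2
      have h4 : (Ideal.absNorm (P ^ (k + 1)) : ℝ) ^ (d : ℝ)⁻¹ ≤ c * X := by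
        rw [← hYd]
        exact Real.rpow_le_rpow (by positivity) (by exact_mod_cast hle) (by positivity)
      have h5 : C * (Ideal.absNorm (P ^ (k + 1)) : ℝ) ^ (d : ℝ)⁻¹ * (X : ℝ) ^ (d - 1) ≤
          C * c * X ^ d := by
        rw [← hXd1]
        calc _ ≤ C * (c * X) * (X : ℝ) ^ (d - 1) := by gcongr
          _ = _ := by ring
      have h6 : ((B.filter (· ∈ P ^ (k + 1))).card : ℝ) * (Ideal.absNorm P : ℝ) ^ (k + 1) ≤
          (1 + C * c) * X ^ d := by
        have : ((Ideal.absNorm (P ^ (k + 1)) : ℕ) : ℝ) = (Ideal.absNorm P : ℝ) ^ (k + 1) := by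
          rw [map_pow, Nat.cast_pow]
        rw [this] at h3 h5
        linarith
      rw [← le_div_iff₀ (by positivity)] at h6
      calc _ ≤ Real.log (Ideal.absNorm P) *
            ((1 + C * c) * X ^ d / (Ideal.absNorm P : ℝ) ^ (k + 1)) := by gcongr
        _ = _ := by ring
    · have : B.filter (· ∈ P ^ (k + 1)) = ∅ := by
        refine Finset.filter_eq_empty_iff.2 fun a ha hmem => hle ?_
        refine le_trans (Nat.le_of_dvd ?_ (Ideal.absNorm_dvd_absNorm_of_le
          ((Ideal.span_singleton_le_iff_mem _).2 hmem))) (hnorm a ha).2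
        have h3 : 0 < X ^ d := Nat.pow_pos hX
        exact h3.trans_le (hnorm a ha).1
      rw [this, Finset.card_empty, Nat.cast_zero, mul_zero]
      positivity
  set M := ∑ P ∈ primeIdealsUpTo F Y with (Ideal.absNorm P).Prime,
    Real.log (Ideal.absNorm P) * ((B.filter (· ∈ P)).card : ℝ) with hM
  set E := ∑ P ∈ primeIdealsUpTo F Y, ∑ k ∈ Finset.range Y,
    if k = 0 ∧ (Ideal.absNorm P).Prime then 0 else
      Real.log (Ideal.absNorm P) * ((B.filter (· ∈ P ^ (k + 1))).card : ℝ) with hE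
  have hTME : T = M + E := by
    rw [hT, hM, hE, Finset.sum_filter, ← Finset.sum_add_distrib]
    refine Finset.sum_congr rfl fun P _ => ?_
    obtain ⟨Z, hZ⟩ : ∃ Z, Y = Z + 1 := ⟨Y - 1, by omega⟩
    rw [hZ, Finset.sum_range_succ', Finset.sum_range_succ']
    by_cases hp : (Ideal.absNorm P).Prime <;> simp [hp, add_comm]
  have hE0 : 0 ≤ E := Finset.sum_nonneg fun P _ => Finset.sum_nonneg fun k _ => by
    have hl : 0 ≤ Real.log (Ideal.absNorm P) := Real.log_natCast_nonneg _
    split_ifs <;> positivity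
  have hEu : E ≤ (1 + C * c) * X ^ d * D := by
    refine le_trans ?_ (mul_le_mul_of_nonneg_left (htail Y) (by positivity))
    rw [hE, Finset.mul_sum]
    refine Finset.sum_le_sum fun P hP => ?_
    rw [Finset.mul_sum]
    refine Finset.sum_le_sum fun k _ => ?_
    split_ifs with h
    · simp
    · exact hterm P hP k
  -- the main contribution
  have hmain : |M - X ^ d * ∑ P ∈ primeIdealsUpTo F Y with (Ideal.absNorm P).Prime,
      Real.log (Ideal.absNorm P) / (Ideal.absNorm P : ℝ)| ≤
      C * (d * (Real.log 4 * (d * c))) * X ^ d := by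
    rw [hM, Finset.mul_sum, ← Finset.sum_sub_distrib]
    refine (Finset.abs_sum_le_sum_abs _ _).trans ?_
    have h1 : ∀ P ∈ (primeIdealsUpTo F Y).filter fun P => (Ideal.absNorm P).Prime,
        |Real.log (Ideal.absNorm P) * ((B.filter (· ∈ P)).card : ℝ) -
          X ^ d * (Real.log (Ideal.absNorm P) / (Ideal.absNorm P : ℝ))| ≤
        C * X ^ (d - 1) *
          (Real.log (Ideal.absNorm P) * (Ideal.absNorm P : ℝ) ^ ((d : ℝ)⁻¹ - 1)) := by
      intro P hP
      obtain ⟨hP, hprime⟩ := Finset.mem_filter.1 hP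
      obtain ⟨hPY, -⟩ := mem_primeIdealsUpTo.1 hP
      have h2 := hequi P hprime.ne_zero hPY
      have hpos : (0 : ℝ) < Ideal.absNorm P := by exact_mod_cast hprime.pos
      have hl : 0 ≤ Real.log (Ideal.absNorm P) := Real.log_natCast_nonneg _
      have e1 : Real.log (Ideal.absNorm P) * ((B.filter (· ∈ P)).card : ℝ) -
          X ^ d * (Real.log (Ideal.absNorm P) / (Ideal.absNorm P : ℝ)) =
          Real.log (Ideal.absNorm P) / (Ideal.absNorm P : ℝ) *
            (((B.filter (· ∈ P)).card : ℝ) * Ideal.absNorm P - X ^ d) := by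
        field_simp
      rw [e1, abs_mul, abs_of_nonneg (by positivity), Real.rpow_sub_one hpos.ne']
      calc _ ≤ Real.log (Ideal.absNorm P) / (Ideal.absNorm P : ℝ) *
            (C * (Ideal.absNorm P : ℝ) ^ ((d : ℝ)⁻¹) * (X : ℝ) ^ (d - 1)) := by gcongr
        _ = _ := by ring
    refine (Finset.sum_le_sum h1).trans ?_
    rw [← Finset.mul_sum, sum_primeIdeals_primeNorm_eq F Y
      fun n => Real.log n * (n : ℝ) ^ ((d : ℝ)⁻¹ - 1)]
    have h3 : ∑ p ∈ primesUpTo Y, degreeOneCount F p * (Real.log p * (p : ℝ) ^ ((d : ℝ)⁻¹ - 1)) ≤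
        d * (Real.log 4 * (d * (c * X))) := by
      calc _ ≤ ∑ p ∈ primesUpTo Y, d * (Real.log p * (p : ℝ) ^ ((d : ℝ)⁻¹ - 1)) := by
            refine Finset.sum_le_sum fun p hp => ?_
            have hl : 0 ≤ Real.log p := Real.log_natCast_nonneg _
            have := degreeOneCount_le F (Finset.mem_filter.1 hp).2
            gcongr
        _ ≤ _ := by
            rw [← Finset.mul_sum]
            have := sum_log_mul_rpow_le (inv_pos.2 hd') (inv_le_one_of_one_le₀ hd1) Y
            rw [inv_inv, hYd] at this
            gcongr
    calc _ ≤ C * X ^ (d - 1) * (d * (Real.log 4 * (d * (c * X)))) := by gcongr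
      _ = C * (d * (Real.log 4 * (d * c))) * (X * X ^ (d - 1)) := by ring
      _ = _ := by rw [hXd1]
  rw [sum_primeIdeals_primeNorm_eq F Y fun n => Real.log n / n] at hmain
  set S := ∑ p ∈ primesUpTo Y, degreeOneCount F p * (Real.log p / p)
  have hlogY : Real.log (Y : ℝ) = d * Real.log (c * X) := by
    rw [hY_def]; push_cast; rw [Real.log_pow]
  have hlogX : Real.log (c * X) = Real.log c + Real.log X := Real.log_mul hc'.ne' hX'.ne'
  rw [hlogY]
  obtain ⟨hm1, hm2⟩ := abs_le.1 hmain
  rw [← mul_le_mul_iff_right₀ hXd, ← abs_of_pos hXd, ← abs_mul, abs_of_pos hXd, abs_le]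
  have hlc : 0 ≤ Real.log c := Real.log_natCast_nonneg _
  have : 0 ≤ (X : ℝ) ^ d * (d * Real.log c) := by positivity
  have : 0 ≤ (1 + C * c) * X ^ d * D := by positivity
  rw [hlogX] at hTu ⊢
  constructor <;> linarith

/-- **Mertens' theorem** for the primes of degree one of a number field. -/
theorem exists_abs_sum_degreeOneCount_sub_log_le (F : Type*) [Field F] [NumberField F] :
    ∃ C : ℝ, ∀ N : ℕ, 1 ≤ N →
      |∑ p ∈ primesUpTo N, degreeOneCount F p * (Real.log p / p) - Real.log N| ≤ C := by
  obtain ⟨c, C, hc, hC, h⟩ := exists_abs_sum_degreeOneCount_sub_log_pow_le F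
  have hd : 0 < Module.finrank ℚ F := Module.finrank_pos
  set d := Module.finrank ℚ F
  have hmono : ∀ M N : ℕ, M ≤ N →
      ∑ p ∈ primesUpTo M, degreeOneCount F p * (Real.log p / p) ≤
        ∑ p ∈ primesUpTo N, degreeOneCount F p * (Real.log p / p) := by
    intro M N hMN
    refine Finset.sum_le_sum_of_subset_of_nonneg
      (Finset.filter_subset_filter _ (Finset.range_mono (by omega))) fun p _ _ => ?_
    have := Real.log_natCast_nonneg p
    positivity
  have hc0 : (0 : ℝ) < c := by exact_mod_cast hc
  refine ⟨C + d * Real.log 2 + d * Real.log c, fun N hN => ?_⟩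
  have hl2 : 0 ≤ (d : ℝ) * Real.log 2 := by positivity
  have hlc : 0 ≤ (d : ℝ) * Real.log c := mul_nonneg (by positivity) (Real.log_natCast_nonneg _)
  have hN0 : (0 : ℝ) < N := by exact_mod_cast hN
  have hex : ∃ X : ℕ, N ≤ (c * (X + 1)) ^ d :=
    ⟨N, (Nat.le_succ N).trans ((Nat.le_mul_of_pos_left _ hc).trans (Nat.le_self_pow hd.ne' _))⟩
  classical
  obtain ⟨X, hX, hmin⟩ : ∃ X : ℕ, N ≤ (c * (X + 1)) ^ d ∧ ∀ m < X, ¬ N ≤ (c * (m + 1)) ^ d :=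
    ⟨Nat.find hex, Nat.find_spec hex, fun m hm => Nat.find_min hex hm⟩
  have h1 := abs_le.1 (h (X + 1) (by omega))
  have hu := hmono _ _ hX
  have hlog : Real.log (((c * (X + 1)) ^ d : ℕ) : ℝ) = d * (Real.log c + Real.log (X + 1)) := by
    push_cast
    rw [Real.log_pow, Real.log_mul hc0.ne' (by positivity)]
  have hlN : Real.log N ≤ d * (Real.log c + Real.log (X + 1)) := by
    rw [← hlog]
    exact Real.log_le_log hN0 (by exact_mod_cast hX)
  rw [hlog] at h1
  rcases X with _ | X
  · have h0 : 0 ≤ ∑ p ∈ primesUpTo N, degreeOneCount F p * (Real.log p / p) :=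
      Finset.sum_nonneg fun p _ => by
        have := Real.log_natCast_nonneg p
        positivity
    have := Real.log_natCast_nonneg N
    simp only [Nat.cast_zero, zero_add, Real.log_one, add_zero] at *
    rw [abs_le]
    constructor <;> linarith
  · have hlt := not_le.1 (hmin X (by omega))
    have h2 := abs_le.1 (h (X + 1) (by omega))
    have hl := hmono _ _ hlt.le
    have hlog' : Real.log (((c * (X + 1)) ^ d : ℕ) : ℝ) =
        d * (Real.log c + Real.log (X + 1)) := by
      push_cast
      rw [Real.log_pow, Real.log_mul hc0.ne' (by positivity)]
    have hlN' : d * (Real.log c + Real.log (X + 1)) ≤ Real.log N := by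
      rw [← hlog']
      refine Real.log_le_log ?_ (by exact_mod_cast hlt.le)
      push_cast; positivity
    rw [hlog'] at h2
    have hlX : Real.log (((X + 1 : ℕ) : ℝ) + 1) ≤ Real.log 2 + Real.log (X + 1) := by
      rw [← Real.log_mul (by norm_num) (by positivity)]
      refine Real.log_le_log (by positivity) ?_
      push_cast; linarith [(Nat.cast_nonneg X : (0 : ℝ) ≤ X)]
    have hlX' := mul_le_mul_of_nonneg_left hlX (Nat.cast_nonneg d : (0 : ℝ) ≤ d)
    rw [abs_le]
    constructor <;> nlinarith

open NumberField UniqueFactorizationMonoid in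
theorem degreeOneCount_eq_card_roots {F : Type*} [Field F] [NumberField F] {θ : 𝓞 F} {p : ℕ}
    [hp : Fact p.Prime] (h : ¬ p ∣ RingOfIntegers.exponent θ) :
    degreeOneCount F p = Nat.card {x : ZMod p // aeval x (minpoly ℤ θ) = 0} := by
  have hg0 : (minpoly ℤ θ).map (Int.castRingHom (ZMod p)) ≠ 0 :=
    map_monic_ne_zero (minpoly.monic θ.isIntegral)
  have hmem : ∀ x : ZMod p, aeval x (minpoly ℤ θ) = 0 ↔
      X - C x ∈ RingOfIntegers.monicFactorsMod θ p := by
    intro x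
    rw [Multiset.mem_toFinset, Polynomial.mem_normalizedFactors_iff hg0, dvd_iff_isRoot,
      IsRoot.def, eval_map, aeval_def, algebraMap_int_eq]
    exact ⟨fun h => ⟨irreducible_X_sub_C x, monic_X_sub_C x, h⟩, fun h => h.2.2⟩
  symm
  refine Nat.card_eq_of_bijective (fun x : {x : ZMod p // aeval x (minpoly ℤ θ) = 0} =>
    (⟨((Ideal.primesOverSpanEquivMonicFactorsMod h).symm ⟨X - C x.1, (hmem _).1 x.2⟩ :
      Ideal (𝓞 F)), ?_⟩ : {I : Ideal (𝓞 F) // Ideal.absNorm I = p})) ⟨?_, ?_⟩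
  · have h1 := NumberField.Ideal.inertiaDeg_primesOverSpanEquivMonicFactorsMod_symm_apply' h
      ((hmem _).1 x.2)
    rw [natDegree_X_sub_C] at h1
    have h2 := ((Ideal.primesOverSpanEquivMonicFactorsMod h).symm
      ⟨X - C x.1, (hmem _).1 x.2⟩).2
    have := h2.1
    have := h2.2
    rw [← Ideal.pow_inertiaDeg p, h1, pow_one]
  · intro x y hxy
    have h0 := congrArg Subtype.val hxy
    have h1 := (Ideal.primesOverSpanEquivMonicFactorsMod h).symm.injective (Subtype.ext h0)
    have h2 : (X - C x.1 : (ZMod p)[X]) = X - C y.1 := Subtype.ext_iff.1 h1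
    exact Subtype.ext (C_injective (sub_right_injective h2))
  · rintro ⟨I, hI⟩
    have hprime : I.IsPrime := Ideal.isPrime_of_irreducible_absNorm (hI ▸ hp.out)
    have hover : I.LiesOver (Ideal.span {(p : ℤ)}) := by
      have hpI : (p : 𝓞 F) ∈ I := hI ▸ Ideal.absNorm_mem I
      constructor
      refine (Int.ideal_span_isMaximal_of_prime p).eq_of_le ?_ ?_
      · exact (hprime.under ℤ).ne_top
      · rw [Ideal.span_singleton_le_iff_mem, Ideal.mem_comap]
        simpa using hpI
    obtain ⟨⟨Q, hQ⟩, hQI⟩ := (Ideal.primesOverSpanEquivMonicFactorsMod h).symm.surjective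
      ⟨I, hprime, hover⟩
    have h1 := NumberField.Ideal.inertiaDeg_primesOverSpanEquivMonicFactorsMod_symm_apply' h hQ
    rw [hQI] at h1
    have h2 := Ideal.pow_inertiaDeg p I
    rw [hI, h1] at h2
    have h3 : Q.natDegree = 1 := Nat.pow_right_injective hp.out.two_le (h2.trans (pow_one p).symm)
    have hmonic : Q.Monic := by
      rw [Multiset.mem_toFinset, Polynomial.mem_normalizedFactors_iff hg0] at hQ
      exact hQ.2.1
    have h4 : Q = X - C (-Q.coeff 0) := by
      rw [hmonic.eq_X_add_C h3]; simp
    have hroot : aeval (-Q.coeff 0) (minpoly ℤ θ) = 0 := (hmem _).2 (h4 ▸ hQ)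
    refine ⟨⟨_, hroot⟩, Subtype.ext ?_⟩
    have h5 : (⟨X - C (-Q.coeff 0), (hmem _).1 hroot⟩ : RingOfIntegers.monicFactorsMod θ p) =
      ⟨Q, hQ⟩ := Subtype.ext h4.symm
    simp only [h5, hQI]

open NumberField in
theorem exists_adjoin_eq_top (F : Type*) [Field F] [NumberField F] :
    ∃ θ : 𝓞 F, Algebra.adjoin ℚ {(θ : F)} = ⊤ := by
  obtain ⟨α, hα⟩ := Field.exists_primitive_element ℚ F
  have hαint : IsIntegral ℚ α := Algebra.IsIntegral.isIntegral α
  obtain ⟨m, hm0, hm⟩ :=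
    ((IsFractionRing.isAlgebraic_iff ℤ ℚ F).2 hαint.isAlgebraic).exists_integral_multiple
  refine ⟨⟨m • α, hm⟩, ?_⟩
  have h1 : Algebra.adjoin ℚ {α} = ⊤ := by
    rw [← IntermediateField.adjoin_simple_toSubalgebra_of_isAlgebraic hαint.isAlgebraic, hα,
      IntermediateField.top_toSubalgebra]
  rw [← top_le_iff, ← h1]
  refine Algebra.adjoin_le ?_
  rw [Set.singleton_subset_iff]
  have h2 : m • α ∈ Algebra.adjoin ℚ {m • α} := Algebra.subset_adjoin rfl
  have h3 := Subalgebra.smul_mem _ h2 ((m : ℚ)⁻¹)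
  rwa [← Int.cast_smul_eq_zsmul ℚ m α, smul_smul,
    inv_mul_cancel₀ (by exact_mod_cast hm0), one_smul, Int.cast_smul_eq_zsmul ℚ m α] at h3

open NumberField in
theorem exponent_ne_zero {F : Type*} [Field F] [NumberField F] {θ : 𝓞 F}
    (h : Algebra.adjoin ℚ {(θ : F)} = ⊤) : RingOfIntegers.exponent θ ≠ 0 := by
  have hθ : IsIntegral ℚ (θ : F) := Algebra.IsIntegral.isIntegral _
  let B := PowerBasis.ofAdjoinEqTop hθ h
  have hgen : B.gen = θ := PowerBasis.ofAdjoinEqTop_gen hθ h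
  have hgenint : IsIntegral ℤ B.gen := hgen ▸ θ.isIntegral_coe
  have hdisc : IsIntegral ℤ (Algebra.discr ℚ B.basis) :=
    Algebra.discr_isIntegral ℚ fun i => by rw [B.basis_eq_pow]; exact hgenint.pow _
  obtain ⟨D, hD⟩ := IsIntegrallyClosed.isIntegral_iff.1 hdisc
  have hD0 : D ≠ 0 := by
    rintro rfl
    exact Algebra.discr_not_zero_of_basis ℚ B.basis (by rw [← hD, map_zero])
  have hmem : (algebraMap ℤ (𝓞 F) D) ∈ conductor ℤ θ := by
    rw [mem_conductor_iff]
    intro b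
    have h1 := Algebra.discr_mul_isIntegral_mem_adjoin (R := ℤ) ℚ hgenint b.isIntegral_coe
    rw [hgen] at h1
    let φ : 𝓞 F →ₐ[ℤ] F := Algebra.algHom ℤ (𝓞 F) F
    have h2 : Algebra.adjoin ℤ {(θ : F)} = (Algebra.adjoin ℤ {θ}).map φ := by
      rw [AlgHom.map_adjoin_singleton]; rfl
    rw [h2] at h1
    obtain ⟨y, hy, hyb⟩ := h1
    have : algebraMap ℤ (𝓞 F) D * b = y := by
      apply RingOfIntegers.coe_injective
      refine Eq.trans ?_ hyb.symm
      rw [← hD, Algebra.smul_def]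
      simp
    rw [this]; exact hy
  intro h0
  rw [RingOfIntegers.exponent, Ideal.absNorm_eq_zero_iff] at h0
  have h1 : D ∈ Ideal.under ℤ (conductor ℤ θ) := hmem
  rw [h0] at h1
  exact hD0 h1

open NumberField in
/-- `σ` acts as the `p`-power map modulo some prime of `𝓞 K` above `p`. -/
def IsFrobeniusAbove (K : Type*) [Field K] [NumberField K] (p : ℕ) (σ : K ≃ₐ[ℚ] K) : Prop :=
  ∃ P : Ideal (𝓞 K), P.IsPrime ∧ (p : 𝓞 K) ∈ P ∧ ∀ x : 𝓞 K, σ • x - x ^ p ∈ P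

open NumberField in
theorem exists_isFrobeniusAbove (K : Type*) [Field K] [NumberField K] [IsGalois ℚ K] {p : ℕ}
    (hp : p.Prime) : ∃ σ, IsFrobeniusAbove K p σ := by
  have := Fact.mk hp
  have hmax : (Ideal.span {(p : ℤ)}).IsMaximal := Int.ideal_span_isMaximal_of_prime p
  obtain ⟨P, hP, hover⟩ := (Ideal.span {(p : ℤ)}).nonempty_primesOver (S := 𝓞 K)
  have hpP : (p : 𝓞 K) ∈ P := by
    have h : (p : ℤ) ∈ P.under ℤ := hover.over ▸ Ideal.mem_span_singleton_self _
    simpa [Ideal.mem_comap] using h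
  have hP0 : P ≠ ⊥ := by
    rintro rfl
    rw [Ideal.mem_bot] at hpP
    exact hp.ne_zero (by exact_mod_cast hpP)
  have : Finite (𝓞 K ⧸ P) := Ideal.finiteQuotientOfFreeOfNeBot P hP0
  obtain ⟨σ, hσ⟩ := IsArithFrobAt.exists_of_isInvariant ℤ (K ≃ₐ[ℚ] K) P
  refine ⟨σ, P, hP, hpP, fun x => ?_⟩
  have h := hσ x
  rw [← hover.over, Int.card_ideal_quot] at h
  simpa using h

open NumberField in
theorem splits_ringOfIntegers {K : Type*} [Field K] [NumberField K] {h : ℤ[X]} (hm : h.Monic)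
    (hs : (h.map (algebraMap ℤ K)).Splits) : (h.map (algebraMap ℤ (𝓞 K))).Splits := by
  have hmap : (h.map (algebraMap ℤ (𝓞 K))).map (algebraMap (𝓞 K) K) = h.map (algebraMap ℤ K) := by
    rw [map_map, ← IsScalarTower.algebraMap_eq]
  refine Splits.of_splits_map_of_injective (i := algebraMap (𝓞 K) K)
    RingOfIntegers.coe_injective (by rwa [hmap]) fun a ha => ?_
  rw [hmap, mem_roots', IsRoot.def, eval_map] at ha
  exact ⟨⟨a, h, hm, ha.2⟩, rfl⟩

theorem card_roots_zmod_eq {k : Type*} [Field k] {p : ℕ} [Fact p.Prime] [CharP k p] (h : ℤ[X]) :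
    Nat.card {x : ZMod p // aeval x h = 0} = Nat.card {y : k // aeval y h = 0 ∧ y ^ p = y} := by
  set c := ZMod.castHom (dvd_refl p) k with hc
  have hcomm : ∀ x, aeval (c x) h = c (aeval x h) := fun x => by
    rw [aeval_def, aeval_def, hom_eval₂]; congr 1; exact RingHom.ext_int _ _
  refine Nat.card_eq_of_bijective (fun x : {x : ZMod p // aeval x h = 0} =>
    (⟨c x, by rw [hcomm, x.2, map_zero], by rw [← map_pow, ZMod.pow_card]⟩ :
      {y : k // aeval y h = 0 ∧ y ^ p = y})) ⟨fun x y hxy => ?_, ?_⟩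
  · exact Subtype.ext (c.injective (Subtype.ext_iff.1 hxy))
  · rintro ⟨y, hy, hyp⟩
    rw [← Subfield.mem_bot_iff_pow_eq_self k, ← ZMod.fieldRange_castHom_eq_bot p] at hyp
    obtain ⟨x, rfl⟩ := hyp
    refine ⟨⟨x, c.injective ?_⟩, rfl⟩
    rw [← hcomm, map_zero]; exact hy

open NumberField in
theorem card_fixed_roots_ringOfIntegers {K : Type*} [Field K] [NumberField K] {h : ℤ[X]}
    (hm : h.Monic) (σ : K ≃ₐ[ℚ] K) :
    Nat.card {a : 𝓞 K // aeval a h = 0 ∧ σ • a = a} =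
      Nat.card {α : K // aeval α h = 0 ∧ σ α = α} := by
  have hcoe : ∀ a : 𝓞 K, aeval (a : K) h = ((aeval a h : 𝓞 K) : K) := fun a =>
    aeval_algebraMap_apply K a h
  have hsmul : ∀ a : 𝓞 K, ((σ • a : 𝓞 K) : K) = σ a := fun a => rfl
  refine Nat.card_eq_of_bijective (fun a : {a : 𝓞 K // aeval a h = 0 ∧ σ • a = a} =>
    (⟨a.1, by rw [hcoe, a.2.1]; rfl, by rw [← hsmul, a.2.2]⟩ :
      {α : K // aeval α h = 0 ∧ σ α = α})) ⟨fun x y hxy => ?_, ?_⟩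
  · have hval := congrArg Subtype.val hxy
    exact Subtype.ext (RingOfIntegers.coe_injective hval)
  · rintro ⟨α, h0, hσ⟩
    obtain ⟨a, rfl⟩ : ∃ a : 𝓞 K, (a : K) = α := ⟨⟨α, h, hm, h0⟩, rfl⟩
    refine ⟨⟨a, RingOfIntegers.coe_injective ?_, RingOfIntegers.coe_injective ?_⟩, rfl⟩
    · exact ((hcoe _).symm.trans h0).trans (map_zero _).symm
    · exact (hsmul _).trans hσ

open NumberField in
theorem exists_card_roots_eq_card_fixed {K : Type*} [Field K] [NumberField K] {h : ℤ[X]}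
    (hm : h.Monic) (hs : (h.map (algebraMap ℤ K)).Splits) :
    ∃ M : ℕ, M ≠ 0 ∧ ∀ p : ℕ, p.Prime → ¬ p ∣ M → ∀ σ, IsFrobeniusAbove K p σ →
      Nat.card {x : ZMod p // aeval x h = 0} =
        Nat.card {α : K // aeval α h = 0 ∧ σ α = α} := by
  classical
  have hsO := splits_ringOfIntegers hm hs
  have hmO : (h.map (algebraMap ℤ (𝓞 K))).Monic := hm.map _
  set R := (h.map (algebraMap ℤ (𝓞 K))).roots with hR
  have hmemR : ∀ a : 𝓞 K, a ∈ R ↔ aeval a h = 0 := fun a => by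
    rw [hR, mem_roots hmO.ne_zero, IsRoot.def, eval_map, aeval_def]
  set D : 𝓞 K := ∏ x ∈ R.toFinset.offDiag, (x.1 - x.2) with hD
  have hD0 : D ≠ 0 := Finset.prod_ne_zero_iff.2 fun x hx =>
    sub_ne_zero.2 (Finset.mem_offDiag.1 hx).2.2
  refine ⟨Ideal.absNorm (Ideal.span {D}), ?_, ?_⟩
  · rwa [Ne, Ideal.absNorm_eq_zero_iff, Ideal.span_singleton_eq_bot]
  rintro p hp hpM σ ⟨P, hP, hpP, hσ⟩
  have := Fact.mk hp
  have hP0 : P ≠ ⊥ := by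
    rintro rfl
    rw [Ideal.mem_bot] at hpP
    exact hp.ne_zero (by exact_mod_cast hpP)
  have hDP : D ∉ P := fun hDP => by
    have h1 : ((Ideal.absNorm (Ideal.span {D}) : ℕ) : 𝓞 K) ∈ P :=
      (Ideal.span_singleton_le_iff_mem P).2 hDP (Ideal.absNorm_mem _)
    obtain ⟨u, v, huv⟩ := Nat.isCoprime_iff_coprime.2 ((Nat.Prime.coprime_iff_not_dvd hp).2 hpM)
    have h2 : (1 : 𝓞 K) = (u : 𝓞 K) * p + v * (Ideal.absNorm (Ideal.span {D}) : ℕ) := by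
      exact_mod_cast congrArg (Int.cast : ℤ → 𝓞 K) huv.symm
    exact hP.ne_top ((Ideal.eq_top_iff_one P).2
      (h2 ▸ P.add_mem (P.mul_mem_left _ hpP) (P.mul_mem_left _ h1)))
  have hinj : ∀ a b : 𝓞 K, aeval a h = 0 → aeval b h = 0 → a - b ∈ P → a = b := by
    intro a b ha hb hab
    by_contra hne
    refine hDP (P.mem_of_dvd (Finset.dvd_prod_of_mem (fun x : 𝓞 K × 𝓞 K => x.1 - x.2)
      (a := (a, b)) ?_) hab)
    rw [Finset.mem_offDiag, Multiset.mem_toFinset, Multiset.mem_toFinset, hmemR, hmemR]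
    exact ⟨ha, hb, hne⟩
  have hmax : P.IsMaximal := hP.isMaximal hP0
  let _ := Ideal.Quotient.field P
  have hchar : CharP (𝓞 K ⧸ P) p := by
    obtain ⟨q, hq⟩ := CharP.exists (𝓞 K ⧸ P)
    have h1 : q ∣ p := (CharP.cast_eq_zero_iff (𝓞 K ⧸ P) q p).1 (by
      rw [← map_natCast (Ideal.Quotient.mk P)]; exact Ideal.Quotient.eq_zero_iff_mem.2 hpP)
    rcases (Nat.dvd_prime hp).1 h1 with rfl | rfl
    · exact absurd rfl (CharP.char_ne_one (𝓞 K ⧸ P) 1)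
    · exact hq
  have hcomm : ∀ a : 𝓞 K, aeval (Ideal.Quotient.mk P a) h = Ideal.Quotient.mk P (aeval a h) :=
    fun a => by
      rw [aeval_def, aeval_def, hom_eval₂]; congr 1
  have hsm : ∀ a : 𝓞 K, aeval a h = 0 → aeval (σ • a) h = 0 := fun a ha => by
    have h1 : aeval (MulSemiringAction.toRingHom (K ≃ₐ[ℚ] K) (𝓞 K) σ a) h =
        MulSemiringAction.toRingHom (K ≃ₐ[ℚ] K) (𝓞 K) σ (aeval a h) := by
      rw [aeval_def, aeval_def, hom_eval₂]; congr 1; exact RingHom.ext_int _ _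
    rw [ha, map_zero] at h1
    exact h1
  have hfrob : ∀ a : 𝓞 K, Ideal.Quotient.mk P (σ • a) = Ideal.Quotient.mk P a ^ p := fun a => by
    rw [← map_pow]; exact Ideal.Quotient.eq.2 (hσ a)
  rw [card_roots_zmod_eq (k := 𝓞 K ⧸ P) h, ← card_fixed_roots_ringOfIntegers hm σ]
  symm
  refine Nat.card_eq_of_bijective (fun a : {a : 𝓞 K // aeval a h = 0 ∧ σ • a = a} =>
    (⟨Ideal.Quotient.mk P a.1, by rw [hcomm, a.2.1, map_zero], by rw [← hfrob, a.2.2]⟩ :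
      {y : 𝓞 K ⧸ P // aeval y h = 0 ∧ y ^ p = y})) ⟨fun x y hxy => ?_, ?_⟩
  · exact Subtype.ext (hinj _ _ x.2.1 y.2.1 (Ideal.Quotient.eq.1 (Subtype.ext_iff.1 hxy)))
  · rintro ⟨y, hy, hyp⟩
    obtain ⟨b, rfl⟩ := Ideal.Quotient.mk_surjective y
    replace hy : Ideal.Quotient.mk P (aeval b h) = 0 := (hcomm b).symm.trans hy
    rw [Ideal.Quotient.eq_zero_iff_mem, aeval_def, ← eval_map,
      hsO.eval_eq_prod_roots_of_monic hmO, hP.multiset_prod_mem_iff_exists_mem] at hy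
    obtain ⟨z, hz, hzP⟩ := hy
    obtain ⟨a, ha, rfl⟩ := Multiset.mem_map.1 hz
    have ha0 := (hmemR a).1 ha
    have hab : Ideal.Quotient.mk P b = Ideal.Quotient.mk P a := Ideal.Quotient.eq.2 hzP
    refine ⟨⟨a, ha0, hinj _ _ (hsm a ha0) ha0 (Ideal.Quotient.eq.1 ?_)⟩,
      Subtype.ext hab.symm⟩
    rw [hfrob, ← hab, hyp]

theorem exists_dvd_eval_iff_exists_aeval_eq_zero (f : ℤ[X]) (p : ℕ) [Fact p.Prime] :
    (∃ n : ℕ, 0 < n ∧ (p : ℤ) ∣ f.eval (n : ℤ)) ↔ ∃ x : ZMod p, aeval x f = 0 := by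
  have key : ∀ n : ℕ, (p : ℤ) ∣ f.eval (n : ℤ) ↔ aeval (n : ZMod p) f = 0 := fun n => by
    have h := hom_eval₂ f (RingHom.id ℤ) (Int.castRingHom (ZMod p)) (n : ℤ)
    rw [aeval_def, ← ZMod.intCast_zmod_eq_zero_iff_dvd]
    change (Int.castRingHom (ZMod p)) (f.eval₂ (RingHom.id ℤ) n) = 0 ↔ _
    rw [h]
    simp
  constructor
  · rintro ⟨n, -, hn⟩
    exact ⟨n, (key n).1 hn⟩
  · rintro ⟨x, hx⟩
    refine ⟨x.val + p, Nat.add_pos_right _ (Fact.out : p.Prime).pos, (key _).2 ?_⟩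
    simpa using hx

theorem exists_aeval_integralNormalization_eq_zero_iff {f : ℤ[X]} (hf : 0 < f.natDegree)
    {k : Type*} [Field k] (h0 : (f.leadingCoeff : k) ≠ 0) (P : k → Prop)
    (hP : ∀ x, P ((f.leadingCoeff : k) * x) ↔ P x) :
    (∃ x : k, aeval x f.integralNormalization = 0 ∧ P x) ↔ ∃ x : k, aeval x f = 0 ∧ P x := by
  have key : ∀ x : k, aeval ((f.leadingCoeff : k) * x) f.integralNormalization = 0 ↔
      aeval x f = 0 := fun x => by
    have h := integralNormalization_eval₂_leadingCoeff_mul hf (algebraMap ℤ k) x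
    rw [aeval_def, aeval_def]
    simp only [algebraMap_int_eq, eq_intCast] at h ⊢
    rw [h, mul_eq_zero, or_iff_right (pow_ne_zero _ h0)]
  constructor
  · rintro ⟨x, hx, hPx⟩
    have hx' : (f.leadingCoeff : k) * ((f.leadingCoeff : k)⁻¹ * x) = x :=
      mul_inv_cancel_left₀ h0 x
    exact ⟨(f.leadingCoeff : k)⁻¹ * x, (key _).1 (by rwa [hx']), (hP _).1 (by rwa [hx'])⟩
  · rintro ⟨x, hx, hPx⟩
    exact ⟨_, (key x).2 hx, (hP x).2 hPx⟩

theorem splits_map_integralNormalization {f : ℤ[X]} {k : Type*} [Field k]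
    (h0 : (f.leadingCoeff : k) ≠ 0) (hs : (f.map (algebraMap ℤ k)).Splits) :
    (f.integralNormalization.map (algebraMap ℤ k)).Splits := by
  have h1 : algebraMap ℤ k f.leadingCoeff ≠ 0 := by simpa using h0
  rw [← integralNormalization_map _ _ h1]
  have h2 := hs.scaleRoots (f.map (algebraMap ℤ k)).leadingCoeff
  rw [← integralNormalization_mul_C_leadingCoeff] at h2
  refine h2.of_dvd ?_ (Dvd.intro _ rfl)
  have hf0 : f.map (algebraMap ℤ k) ≠ 0 := fun h => h1 (by
    have := congrArg (fun q => coeff q f.natDegree) h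
    simpa [coeff_map] using this)
  exact mul_ne_zero (monic_integralNormalization hf0).ne_zero
    (C_ne_zero.2 (leadingCoeff_ne_zero.2 hf0))

theorem exists_dvd_eval_iff_exists_fixed_root {K : Type*} [Field K] [NumberField K] {f : ℤ[X]}
    (hf : 0 < f.natDegree) (hs : (f.map (algebraMap ℤ K)).Splits) :
    ∃ M : ℕ, M ≠ 0 ∧ ∀ p : ℕ, p.Prime → ¬ p ∣ M → ∀ σ, IsFrobeniusAbove K p σ →
      ((∃ n : ℕ, 0 < n ∧ (p : ℤ) ∣ f.eval (n : ℤ)) ↔ ∃ α : K, aeval α f = 0 ∧ σ α = α) := by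
  have hf0 : f ≠ 0 := by rintro rfl; simp at hf
  have hl : f.leadingCoeff ≠ 0 := leadingCoeff_ne_zero.2 hf0
  have hlK : (f.leadingCoeff : K) ≠ 0 := Int.cast_ne_zero.2 hl
  have hm := monic_integralNormalization hf0
  obtain ⟨M, hM, h⟩ := exists_card_roots_eq_card_fixed hm (splits_map_integralNormalization hlK hs)
  refine ⟨M * f.leadingCoeff.natAbs, mul_ne_zero hM (Int.natAbs_ne_zero.2 hl), ?_⟩
  intro p hp hpM σ hσ
  have := Fact.mk hp
  have hcard := h p hp (fun hd => hpM (hd.mul_right _)) σ hσ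
  have hlp : (f.leadingCoeff : ZMod p) ≠ 0 := fun h0 => hpM (by
    rw [ZMod.intCast_zmod_eq_zero_iff_dvd, Int.natCast_dvd] at h0
    exact h0.mul_left _)
  have h1 := exists_aeval_integralNormalization_eq_zero_iff hf hlp (fun _ => True)
    (fun _ => Iff.rfl)
  have h2 := exists_aeval_integralNormalization_eq_zero_iff hf hlK (fun x => σ x = x)
    (fun x => by rw [map_mul, map_intCast]; exact mul_right_inj' hlK)
  simp only [and_true] at h1
  rw [exists_dvd_eval_iff_exists_aeval_eq_zero, ← h1, ← h2]
  have hfin : Finite {α : K // aeval α f.integralNormalization = 0 ∧ σ α = α} := by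
    refine Set.Finite.subset (f.integralNormalization.rootSet_finite K) fun α hα => ?_
    exact (mem_rootSet_of_ne hm.ne_zero).2 hα.1
  rw [← nonempty_subtype, ← nonempty_subtype, ← Finite.card_pos_iff, ← Finite.card_pos_iff, hcard]

open NumberField in
theorem exists_card_mul_degreeOneCount_eq {K : Type*} [Field K] [NumberField K] [IsGalois ℚ K]
    (D : Subgroup (K ≃ₐ[ℚ] K)) :
    ∃ M : ℕ, M ≠ 0 ∧ ∀ p : ℕ, p.Prime → ¬ p ∣ M → ∀ σ, IsFrobeniusAbove K p σ →
      Nat.card D * degreeOneCount (IntermediateField.fixedField D) p =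
        Nat.card {τ : K ≃ₐ[ℚ] K // τ⁻¹ * σ * τ ∈ D} := by
  set F := IntermediateField.fixedField D with hF
  obtain ⟨θ, hθ⟩ := exists_adjoin_eq_top F
  set t : K := algebraMap F K (θ : F) with ht
  have hstab : ∀ τ : K ≃ₐ[ℚ] K, τ t = t ↔ τ ∈ D := by
    intro τ
    rw [← IntermediateField.fixingSubgroup_fixedField D, IntermediateField.mem_fixingSubgroup_iff]
    refine ⟨fun h x hx => ?_, fun h => h _ (θ : F).2⟩
    have hext : (τ : K →ₐ[ℚ] K).comp F.val = F.val :=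
      AlgHom.ext_of_adjoin_eq_top hθ (by rintro _ rfl; exact h)
    exact DFunLike.congr_fun hext (⟨x, hx⟩ : F)
  have htint : IsIntegral ℤ t := (θ.isIntegral_coe).algebraMap
  have hmin : minpoly ℤ θ = minpoly ℤ t := by
    rw [ht, minpoly.algebraMap_eq (algebraMap F K).injective]
    exact (minpoly.algebraMap_eq RingOfIntegers.coe_injective θ).symm
  have hmQ : minpoly ℚ t = (minpoly ℤ t).map (algebraMap ℤ ℚ) :=
    minpoly.isIntegrallyClosed_eq_field_fractions' ℚ htint
  have hs : ((minpoly ℤ t).map (algebraMap ℤ K)).Splits := by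
    rw [IsScalarTower.algebraMap_eq ℤ ℚ K, ← map_map, ← hmQ]
    exact IsGalois.splits ℚ t
  have hroot : ∀ α : K, aeval α (minpoly ℤ t) = 0 ↔ ∃ τ : K ≃ₐ[ℚ] K, τ t = α := by
    intro α
    rw [← isConjRoot_iff_exists_algEquiv, IsConjRoot.comm,
      isConjRoot_iff_aeval_eq_zero (IsGalois.integral ℚ t), hmQ, aeval_map_algebraMap]
  obtain ⟨M, hM, h⟩ := exists_card_roots_eq_card_fixed (minpoly.monic htint) hs
  refine ⟨M * RingOfIntegers.exponent θ, mul_ne_zero hM (exponent_ne_zero hθ), ?_⟩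
  intro p hp hpM σ hσ
  have := Fact.mk hp
  rw [degreeOneCount_eq_card_roots (θ := θ) (fun hd => hpM (hd.mul_left _)), hmin,
    h p hp (fun hd => hpM (hd.mul_right _)) σ hσ, ← Nat.card_prod]
  choose s hs using fun α : {α : K // aeval α (minpoly ℤ t) = 0 ∧ σ α = α} => (hroot α.1).1 α.2.1
  refine Nat.card_eq_of_bijective
    (fun x : D × {α : K // aeval α (minpoly ℤ t) = 0 ∧ σ α = α} =>
      (⟨s x.2 * x.1, ?_⟩ : {τ : K ≃ₐ[ℚ] K // τ⁻¹ * σ * τ ∈ D})) ⟨?_, ?_⟩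
  · rw [← hstab]
    have h1 : (x.1 : K ≃ₐ[ℚ] K) t = t := (hstab _).2 x.1.2
    have h2 : (s x.2 * x.1) t = x.2 := by rw [AlgEquiv.mul_apply, h1, hs]
    rw [AlgEquiv.mul_apply, AlgEquiv.mul_apply, h2, x.2.2.2, ← h2, ← AlgEquiv.mul_apply,
      inv_mul_cancel, AlgEquiv.one_apply]
  · rintro ⟨d, α⟩ ⟨d', α'⟩ hx
    have hx' : s α * d = s α' * d' := Subtype.ext_iff.1 hx
    have hα : α = α' := Subtype.ext (by
      rw [← hs α, ← hs α', ← (hstab _).2 d.2, ← AlgEquiv.mul_apply, hx', AlgEquiv.mul_apply,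
        (hstab _).2 d'.2, (hstab _).2 d.2])
    subst hα
    exact Prod.ext (Subtype.ext (mul_left_cancel hx')) rfl
  · rintro ⟨τ, hτ⟩
    rw [← hstab] at hτ
    have hτ' : σ (τ t) = τ t := by
      rw [AlgEquiv.mul_apply, AlgEquiv.mul_apply] at hτ
      have := congrArg τ hτ
      rwa [← AlgEquiv.mul_apply, mul_inv_cancel, AlgEquiv.one_apply] at this
    set α : {α : K // aeval α (minpoly ℤ t) = 0 ∧ σ α = α} := ⟨τ t, (hroot _).2 ⟨τ, rfl⟩, hτ'⟩
      with hα
    have hd : (s α)⁻¹ * τ ∈ D := by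
      rw [← hstab, AlgEquiv.mul_apply]
      change (s α)⁻¹ α.1 = t
      rw [← hs α, ← AlgEquiv.mul_apply, inv_mul_cancel, AlgEquiv.one_apply]
    exact ⟨(⟨_, hd⟩, α), Subtype.ext (mul_inv_cancel_left _ _)⟩

open Classical in
theorem exists_eq_sum_subgroup_indicator {G : Type*} [Group G] [Finite G] [Fintype (Subgroup G)]
    (φ : G → ℝ) (hφ : ∀ σ τ, Subgroup.zpowers σ = Subgroup.zpowers τ → φ σ = φ τ) :
    ∃ c : Subgroup G → ℝ, ∀ τ, φ τ = ∑ D, c D * (if τ ∈ D then 1 else 0) := by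
  suffices H : ∀ n : ℕ, ∀ φ : G → ℝ,
      (∀ σ τ, Subgroup.zpowers σ = Subgroup.zpowers τ → φ σ = φ τ) →
      (∀ τ, n < orderOf τ → φ τ = 0) →
      ∃ c : Subgroup G → ℝ, ∀ τ, φ τ = ∑ D, c D * (if τ ∈ D then 1 else 0) from
    H (Nat.card G) φ hφ fun τ hτ => absurd (orderOf_le_card (x := τ)) (not_le.2 hτ)
  intro n
  induction n with
  | zero => exact fun φ _ h0 => ⟨0, fun τ => by simp [h0 τ (orderOf_pos τ)]⟩
  | succ n ih =>
    intro φ hφ h0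
    set c₀ : Subgroup G → ℝ := fun D =>
      if h : ∃ g, Subgroup.zpowers g = D ∧ orderOf g = n + 1 then φ h.choose else 0 with hc₀
    have hc₀_zero : ∀ D : Subgroup G, Nat.card D ≠ n + 1 → c₀ D = 0 := fun D hD => by
      refine dif_neg ?_
      rintro ⟨g, rfl, hg⟩
      exact hD (by rw [Nat.card_zpowers, hg])
    have hc₀_zpowers : ∀ τ, orderOf τ = n + 1 → c₀ (Subgroup.zpowers τ) = φ τ := fun τ hτ => by
      have h : ∃ g, Subgroup.zpowers g = Subgroup.zpowers τ ∧ orderOf g = n + 1 := ⟨τ, rfl, hτ⟩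
      rw [hc₀]
      simp only [dif_pos h]
      exact hφ _ _ h.choose_spec.1
    have hterm : ∀ τ, n + 1 ≤ orderOf τ → ∀ D, D ≠ Subgroup.zpowers τ →
        c₀ D * (if τ ∈ D then 1 else 0) = 0 := by
      intro τ hτ D hD
      by_cases hm : τ ∈ D
      · rw [hc₀_zero D, zero_mul]
        intro hcard
        refine hD (Subgroup.eq_of_le_of_card_ge (Subgroup.zpowers_le.2 hm) ?_).symm
        rwa [hcard, Nat.card_zpowers]
      · rw [if_neg hm, mul_zero]
    set ψ : G → ℝ := fun τ => φ τ - ∑ D, c₀ D * (if τ ∈ D then 1 else 0) with hψ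
    have hψ_zpowers : ∀ σ τ, Subgroup.zpowers σ = Subgroup.zpowers τ → ψ σ = ψ τ := by
      intro σ τ hst
      simp only [hψ, hφ σ τ hst, ← Subgroup.zpowers_le, hst]
    have hψ_zero : ∀ τ, n < orderOf τ → ψ τ = 0 := by
      intro τ hτ
      rw [hψ]
      beta_reduce
      rw [Finset.sum_eq_single (Subgroup.zpowers τ) (fun D _ => hterm τ hτ D)
        (fun h => absurd (Finset.mem_univ _) h), if_pos (Subgroup.mem_zpowers τ), mul_one, sub_eq_zero]
      rcases (Nat.succ_le_of_lt hτ).eq_or_lt with h | h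
      · exact (hc₀_zpowers τ h.symm).symm
      · rw [h0 τ h, hc₀_zero]
        rw [Nat.card_zpowers]; exact h.ne'
    obtain ⟨c, hc⟩ := ih ψ hψ_zpowers hψ_zero
    refine ⟨fun D => c D + c₀ D, fun τ => ?_⟩
    simp only [add_mul, Finset.sum_add_distrib]
    rw [← hc τ, hψ]; ring

open Classical in
theorem exists_indicator_eq_sum_degreeOneCount {K : Type*} [Field K] [NumberField K]
    [IsGalois ℚ K] [Fintype (Subgroup (K ≃ₐ[ℚ] K))] {f : ℤ[X]}
    (hf : 0 < f.natDegree) (hs : (f.map (algebraMap ℤ K)).Splits) :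
    ∃ M : ℕ, M ≠ 0 ∧ ∃ w : Subgroup (K ≃ₐ[ℚ] K) → ℝ,
      ∑ D, w D = (Nat.card {σ : K ≃ₐ[ℚ] K | ∃ α : K, aeval α f = 0 ∧ σ α = α} : ℝ) /
        Nat.card (K ≃ₐ[ℚ] K) ∧
      ∀ p : ℕ, p.Prime → ¬ p ∣ M →
        (if ∃ n : ℕ, 0 < n ∧ (p : ℤ) ∣ f.eval (n : ℤ) then (1 : ℝ) else 0) =
          ∑ D, w D * degreeOneCount (IntermediateField.fixedField D) p := by
  set G := K ≃ₐ[ℚ] K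
  have := Fintype.ofFinite G
  set Q : G → Prop := fun σ => ∃ α : K, aeval α f = 0 ∧ σ α = α with hQ
  set φ : G → ℝ := fun σ => if Q σ then 1 else 0 with hφ
  have hfix : ∀ (σ τ : G) (α : K), τ ∈ Subgroup.zpowers σ → σ α = α → τ α = α := by
    intro σ τ α h hα
    have h1 : Subgroup.zpowers σ ≤ MulAction.stabilizer G α := Subgroup.zpowers_le.2 hα
    exact h1 h
  obtain ⟨c, hc⟩ := exists_eq_sum_subgroup_indicator φ (fun σ τ h => by
    have hQQ : Q σ ↔ Q τ := by
      constructor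
      · rintro ⟨α, h0, hα⟩
        exact ⟨α, h0, hfix σ τ α (h ▸ Subgroup.mem_zpowers τ) hα⟩
      · rintro ⟨α, h0, hα⟩
        exact ⟨α, h0, hfix τ σ α (h ▸ Subgroup.mem_zpowers σ) hα⟩
    simp only [hφ, hQQ])
  have hconj : ∀ σ τ : G, φ (τ⁻¹ * σ * τ) = φ σ := by
    have hroot : ∀ (τ : G) (α : K), aeval α f = 0 → aeval (τ α) f = 0 := fun τ α h => by
      have h1 := aeval_algHom_apply ((τ : K →ₐ[ℚ] K).restrictScalars ℤ) α f
      rw [h, map_zero] at h1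
      exact h1
    have himp : ∀ σ τ : G, Q σ → Q (τ⁻¹ * σ * τ) := by
      rintro σ τ ⟨α, h0, hα⟩
      refine ⟨τ⁻¹ α, hroot _ _ h0, ?_⟩
      rw [AlgEquiv.mul_apply, AlgEquiv.mul_apply, ← AlgEquiv.mul_apply τ, mul_inv_cancel,
        AlgEquiv.one_apply, hα]
    intro σ τ
    have hQQ : Q (τ⁻¹ * σ * τ) ↔ Q σ := by
      refine ⟨fun h => ?_, himp σ τ⟩
      have h2 := himp _ τ⁻¹ h
      rwa [show τ⁻¹⁻¹ * (τ⁻¹ * σ * τ) * τ⁻¹ = σ by group] at h2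
    simp only [hφ, hQQ]
  have hcount : ∀ q : G → Prop, ∑ τ, (if q τ then (1 : ℝ) else 0) = Nat.card {τ : G // q τ} :=
    fun q => by rw [Finset.sum_boole, Nat.card_eq_fintype_card, Fintype.card_subtype]
  have hG : (Nat.card G : ℝ) ≠ 0 := Nat.cast_ne_zero.2 Nat.card_pos.ne'
  obtain ⟨M₀, hM₀, h₀⟩ := exists_dvd_eval_iff_exists_fixed_root hf hs
  choose M hM h using fun D : Subgroup G => exists_card_mul_degreeOneCount_eq D
  refine ⟨M₀ * ∏ D, M D, mul_ne_zero hM₀ (Finset.prod_ne_zero_iff.2 fun D _ => hM D),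
    fun D => c D * Nat.card D / Nat.card G, ?_, ?_⟩
  · rw [← Finset.sum_div]
    congr 1
    have h1 : (Nat.card {σ : G | Q σ} : ℝ) = ∑ τ, φ τ := (hcount Q).symm
    rw [h1, Finset.sum_congr rfl fun τ _ => hc τ, Finset.sum_comm]
    refine Finset.sum_congr rfl fun D _ => ?_
    rw [← Finset.mul_sum, hcount]
  · intro p hp hpM
    obtain ⟨σ, hσ⟩ := exists_isFrobeniusAbove K hp
    have h1 : (if ∃ n : ℕ, 0 < n ∧ (p : ℤ) ∣ f.eval (n : ℤ) then (1 : ℝ) else 0) = φ σ := by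
      simp only [h₀ p hp (fun hd => hpM (hd.mul_right _)) σ hσ, hφ, hQ]
    have h2 : Nat.card G * φ σ = ∑ τ, φ (τ⁻¹ * σ * τ) := by
      simp [hconj, Nat.card_eq_fintype_card]
    have h3 : φ σ = (∑ τ, φ (τ⁻¹ * σ * τ)) / Nat.card G := by
      rw [← h2, mul_div_cancel_left₀ _ hG]
    rw [h1, h3, Finset.sum_congr rfl fun τ _ => hc (τ⁻¹ * σ * τ), Finset.sum_comm, Finset.sum_div]
    refine Finset.sum_congr rfl fun D _ => ?_
    have h4 := h D p hp (fun hd => hpM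
      ((hd.trans (Finset.dvd_prod_of_mem M (Finset.mem_univ D))).mul_left _)) σ hσ
    rw [← Finset.mul_sum, hcount, ← h4]
    push_cast
    ring

theorem exists_sum_abs_le_of_le_rpow {e : ℕ → ℝ} {M : ℕ} (hM : M ≠ 0)
    (he : ∀ p : ℕ, p.Prime → ¬ p ∣ M → |e p| ≤ 8 * (p : ℝ) ^ (-(3 / 2) : ℝ)) :
    ∃ C : ℝ, ∀ N : ℕ, ∑ p ∈ primesUpTo N, |e p| ≤ C := by
  obtain ⟨C, -, hC⟩ := exists_sum_rpow_le (s := -(3 / 2)) (by norm_num)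
  refine ⟨8 * C + ∑ p ∈ M.primeFactors, |e p|, fun N => ?_⟩
  rw [← Finset.sum_filter_not_add_sum_filter _ (fun p => p ∣ M)]
  refine add_le_add ?_ (Finset.sum_le_sum_of_subset_of_nonneg (fun p hp => ?_)
    fun _ _ _ => abs_nonneg _)
  · calc _ ≤ ∑ p ∈ (primesUpTo N).filter (fun p => ¬ p ∣ M), 8 * (p : ℝ) ^ (-(3 / 2) : ℝ) :=
          Finset.sum_le_sum fun p hp => by
            rw [Finset.mem_filter, Finset.mem_filter] at hp
            exact he p hp.1.2 hp.2
      _ ≤ 8 * C := by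
          rw [← Finset.mul_sum]
          exact mul_le_mul_of_nonneg_left (hC _) (by norm_num)
  · rw [Finset.mem_filter, Finset.mem_filter] at hp
    exact Nat.mem_primeFactors.2 ⟨hp.1.2, hp.2, hM⟩

open Classical in
theorem exists_abs_sum_indicator_sub_log_le {K : Type*} [Field K] [NumberField K] [IsGalois ℚ K]
    {f : ℤ[X]} (hf : 0 < f.natDegree) (hs : (f.map (algebraMap ℤ K)).Splits) :
    ∃ C : ℝ, ∀ N : ℕ, 1 ≤ N →
      |∑ p ∈ primesUpTo N, (if ∃ n : ℕ, 0 < n ∧ (p : ℤ) ∣ f.eval (n : ℤ) then (1 : ℝ) else 0) *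
          (Real.log p / ((p : ℝ) - 1)) -
        (Nat.card {σ : K ≃ₐ[ℚ] K | ∃ α : K, aeval α f = 0 ∧ σ α = α} : ℝ) /
          Nat.card (K ≃ₐ[ℚ] K) * Real.log N| ≤ C := by
  have := Fintype.ofFinite (Subgroup (K ≃ₐ[ℚ] K))
  obtain ⟨M, hM, w, hw, h⟩ := exists_indicator_eq_sum_degreeOneCount hf hs
  choose B hB using fun D : Subgroup (K ≃ₐ[ℚ] K) =>
    exists_abs_sum_degreeOneCount_sub_log_le (IntermediateField.fixedField D)
  set u : ℕ → ℝ := fun p => if ∃ n : ℕ, 0 < n ∧ (p : ℤ) ∣ f.eval (n : ℤ) then (1 : ℝ) else 0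
    with hu
  set v : ℕ → ℝ := fun p => ∑ D, w D * degreeOneCount (IntermediateField.fixedField D) p with hv
  obtain ⟨C, hC⟩ := exists_sum_abs_le_of_le_rpow
    (e := fun p => u p * (Real.log p / ((p : ℝ) - 1)) - v p * (Real.log p / p)) hM
    (fun p hp hpM => by
      have huv : v p = u p := (h p hp hpM).symm
      have hu1 : |u p| ≤ 1 := by
        simp only [hu]; split_ifs <;> simp
      rw [huv, ← mul_sub, abs_mul]
      calc _ ≤ 1 * |Real.log p / ((p : ℝ) - 1) - Real.log p / p| :=
            mul_le_mul_of_nonneg_right hu1 (abs_nonneg _)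
        _ ≤ _ := by rw [one_mul]; exact abs_log_div_sub_log_div_le hp)
  refine ⟨C + ∑ D, |w D| * B D, fun N hN => ?_⟩
  rw [← hw]
  have hsplit : ∑ p ∈ primesUpTo N, u p * (Real.log p / ((p : ℝ) - 1)) - (∑ D, w D) * Real.log N =
      ∑ p ∈ primesUpTo N, (u p * (Real.log p / ((p : ℝ) - 1)) - v p * (Real.log p / p)) +
      ∑ D, w D * (∑ p ∈ primesUpTo N, degreeOneCount (IntermediateField.fixedField D) p *
        (Real.log p / p) - Real.log N) := by
    have hvs : ∑ p ∈ primesUpTo N, v p * (Real.log p / p) = ∑ D, w D * ∑ p ∈ primesUpTo N,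
        degreeOneCount (IntermediateField.fixedField D) p * (Real.log p / p) := by
      simp only [hv, Finset.sum_mul, Finset.mul_sum]
      rw [Finset.sum_comm]
      simp only [mul_assoc]
    rw [Finset.sum_sub_distrib, hvs]
    simp only [mul_sub, Finset.sum_sub_distrib, Finset.sum_mul]
    ring
  rw [hsplit]
  refine (abs_add_le _ _).trans (add_le_add
    ((Finset.abs_sum_le_sum_abs _ _).trans (hC N)) ((Finset.abs_sum_le_sum_abs _ _).trans ?_))
  refine Finset.sum_le_sum fun D _ => ?_
  rw [abs_mul]
  exact mul_le_mul_of_nonneg_left (hB D N hN) (abs_nonneg _)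

/-- Mertens-type estimate: for a nonconstant `f ∈ ℤ[X]` with prime-density
`δ_f = #{σ ∈ Gal(K/ℚ) : σ fixes some root of f}/#Gal(K/ℚ)`, the sum of `log p/(p−1)` over
the primes `p ≤ N` dividing some value of `f` equals `δ_f log N + O_f(1)`. -/
theorem stmt_12 (f : Polynomial ℤ) (hf : 0 < f.natDegree)
    (K : Type) [Field K] [Algebra ℚ K]
    (hK : Polynomial.IsSplittingField ℚ K (f.map (Int.castRingHom ℚ)))
    (δ : ℝ)
    (hδ : δ = (Nat.card {σ : K ≃ₐ[ℚ] K |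
        ∃ α ∈ (f.map (Int.castRingHom ℚ)).rootSet K, σ α = α} : ℝ)
      / (Nat.card (K ≃ₐ[ℚ] K) : ℝ)) :
    ∃ C : ℝ, 0 < C ∧ ∀ N : ℕ, 2 ≤ N →
      |(∑ p ∈ Finset.range (N + 1),
          Set.indicator {p : ℕ | p.Prime ∧ ∃ n : ℕ, 0 < n ∧ (p : ℤ) ∣ f.eval (n : ℤ)}
            (fun p => Real.log p / ((p : ℝ) - 1)) p)
          - δ * Real.log N| ≤ C := by
  classical
  have hfQ : f.map (Int.castRingHom ℚ) ≠ 0 :=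
    (Polynomial.map_ne_zero_iff (Int.castRingHom ℚ).injective_int).2 (by rintro rfl; simp at hf)
  have hchar : CharZero K := charZero_of_injective_algebraMap (algebraMap ℚ K).injective
  obtain rfl : ‹Algebra ℚ K› = DivisionRing.toRatAlgebra := Subsingleton.elim _ _
  have hfin : FiniteDimensional ℚ K := IsSplittingField.finiteDimensional K
    (f.map (Int.castRingHom ℚ))
  have hnf : NumberField K := .mk
  have hnormal : Normal ℚ K := Normal.of_isSplittingField (f.map (Int.castRingHom ℚ))
  have hgal : IsGalois ℚ K := ⟨⟩
  have hs : (f.map (algebraMap ℤ K)).Splits := by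
    rw [IsScalarTower.algebraMap_eq ℤ ℚ K, ← map_map]
    exact hK.splits
  have hset : {σ : K ≃ₐ[ℚ] K | ∃ α ∈ (f.map (Int.castRingHom ℚ)).rootSet K, σ α = α} =
      {σ : K ≃ₐ[ℚ] K | ∃ α : K, aeval α f = 0 ∧ σ α = α} := by
    ext σ
    refine exists_congr fun α => and_congr_left' ?_
    rw [mem_rootSet_of_ne hfQ, ← algebraMap_int_eq, aeval_map_algebraMap]
  obtain ⟨C, hC⟩ := exists_abs_sum_indicator_sub_log_le hf hs
  refine ⟨max C 1, lt_max_of_lt_right one_pos, fun N hN => ?_⟩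
  refine le_trans (le_of_eq ?_) ((hC N (by lia)).trans (le_max_left _ _))
  rw [hδ, hset, Finset.sum_filter]
  congr 2
  refine Finset.sum_congr rfl fun p _ => ?_
  by_cases hp : p.Prime <;> simp [Set.indicator, hp]
end

section
/- Let k ≥ 2 be an integer and let d be the product of the first k primes. Then for every integer n ≥ 0 and all indices i, j with 1 ≤ i < j ≤ k, the integers 1 + d(n + i) and 1 + d(n + j) are coprime. Consequently, for f(X) = (1 + dX)², every member of the block f(n+1), …, f(n+k) is coprime to all the others, so that g_f ≥ k. -/
open scoped BigOperators

/-- Every prime below `k` is among the first `k` primes. -/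
theorem Nat.Prime.dvd_prod_nth_prime {p k : ℕ} (hp : p.Prime) (hpk : p < k) :
    p ∣ ∏ i ∈ Finset.range k, Nat.nth Nat.Prime i := by
  have hmem : Nat.count Nat.Prime p ∈ Finset.range k :=
    Finset.mem_range.2 ((Nat.count_le _).trans_lt hpk)
  have hdvd := Finset.dvd_prod_of_mem (Nat.nth Nat.Prime) hmem
  rwa [Nat.nth_count hp] at hdvd

/-- If every prime below `k` divides `d`, then `1 + d * a` and `1 + d * b` are coprime
whenever `0 < b - a < k`. -/
theorem coprime_one_add_mul {d k a b : ℕ} (hd : ∀ p, p.Prime → p < k → p ∣ d)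
    (hab : a < b) (hbk : b < a + k) : Nat.Coprime (1 + d * a) (1 + d * b) := by
  refine Nat.coprime_of_dvd fun p hp ha hb => ?_
  have hpd : ¬ p ∣ d := fun h =>
    hp.one_lt.ne' (Nat.dvd_one.1 ((Nat.dvd_add_left (h.mul_right a)).1 ha))
  have hsub : p ∣ d * (b - a) := by
    have h := Nat.dvd_sub hb ha
    rwa [Nat.add_sub_add_left, ← Nat.mul_sub] at h
  have hle := Nat.le_of_dvd (by omega) ((hp.dvd_mul.1 hsub).resolve_left hpd)
  exact hpd (hd p hp (by omega))

/-- With `d` the product of the first `k` primes (`k ≥ 2`), any two distinct members of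
`1 + d(n+1), …, 1 + d(n+k)` are coprime; hence every member of the block
`f(n+1), …, f(n+k)` for `f(X) = (1 + dX)²` is coprime to all the others. -/
theorem stmt_15 (k : ℕ) (hk : 2 ≤ k) (d : ℕ)
    (hd : d = ∏ i ∈ Finset.range k, Nat.nth Nat.Prime i) :
    (∀ n : ℕ, ∀ i j : ℕ, 1 ≤ i → i < j → j ≤ k →
      IsCoprime (1 + (d : ℤ) * ((n + i : ℕ) : ℤ)) (1 + (d : ℤ) * ((n + j : ℕ) : ℤ))) ∧
    (∀ n : ℕ, ∀ i ∈ Finset.Icc 1 k, ∀ j ∈ Finset.Icc 1 k, i ≠ j →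
      Int.gcd ((1 + (d : ℤ) * ((n + i : ℕ) : ℤ)) ^ 2)
        ((1 + (d : ℤ) * ((n + j : ℕ) : ℤ)) ^ 2) = 1) := by
  have key : ∀ n i j : ℕ, 1 ≤ i → i < j → j ≤ k →
      IsCoprime (1 + (d : ℤ) * ((n + i : ℕ) : ℤ)) (1 + (d : ℤ) * ((n + j : ℕ) : ℤ)) := by
    intro n i j hi hij hj
    have h : Nat.Coprime (1 + d * (n + i)) (1 + d * (n + j)) :=
      coprime_one_add_mul (k := k) (fun p hp hpk => hd ▸ hp.dvd_prod_nth_prime hpk)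
        (by omega) (by omega)
    exact_mod_cast Nat.isCoprime_iff_coprime.2 h
  refine ⟨key, fun n i hi j hj hij => ?_⟩
  rw [Finset.mem_Icc] at hi hj
  rw [← Int.isCoprime_iff_gcd_eq_one]
  rcases lt_or_gt_of_ne hij with h | h
  · exact (key n i j hi.1 h hj.2).pow
  · exact (key n j i hj.1 h hi.2).symm.pow
end
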